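/- Let k ≥ 2 and d ≥ 1 be fixed integers. There exists a constant C > 0, depending only on k and d, such that for every odd prime power q and every admissible symmetric polynomial f ∈ F_q[x_1,…,x_k] of total degree d, the hypergraph Y_{f,q} satisfies |N*_{Y_{f,q}}(𝒪_k^e) − q^{2k}/2| ≤ C·q^{2k−1}. -/

import Mathlib

open MvPolynomial

/-- Substitute: variable `0` of `f` is kept as the polynomial indeterminate `X`, and
variable `j+1` is replaced by `u j`.  This produces the univariate polynomial
`f(x, u_2, …, u_k)`. -/
noncomputable def substX {F : Type*} [Field F] {k : ℕ} (f : MvPolynomial (Fin k) F)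
    (u : Fin (k - 1) → F) : Polynomial F :=
  MvPolynomial.aeval (fun i : Fin k =>
    if h : (i : ℕ) = 0 then (Polynomial.X : Polynomial F)
    else Polynomial.C (u ⟨(i : ℕ) - 1, by have := i.isLt; omega⟩)) f

/-- A polynomial `f ∈ F_q[x_1,…,x_k]` is admissible if it is not a constant multiple of a
square of a polynomial, and the coefficients `H_0,…,H_d` of `f` as a polynomial in `x_1`
have no common zero over the algebraic closure, equivalently, for every point
`v = (v_2,…,v_k)` over the algebraic closure, the univariate polynomial `f(x, v_2,…,v_k)`
is not identically zero. -/
def Admissible {F : Type*} [Field F] {k : ℕ} (f : MvPolynomial (Fin k) F) : Prop :=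
  (¬ ∃ (c : F) (g : MvPolynomial (Fin k) F), f = MvPolynomial.C c * g ^ 2) ∧
  ∀ v : Fin (k - 1) → AlgebraicClosure F,
    substX (MvPolynomial.map (algebraMap F (AlgebraicClosure F)) f) v ≠ 0

/-- The number of labeled induced even partial octahedrons in the hypergraph `Y_{f,q}`:
the number of injective maps `u : [k] × {0,1} → F_q` such that the number of `ε ∈ {0,1}^k`
with `{u(1,ε_1),…,u(k,ε_k)}` not an edge (i.e. `f(u(1,ε_1),…,u(k,ε_k))` not a square)
is even. -/
noncomputable def NEPO {F : Type*} [Field F] [Fintype F] {k : ℕ}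
    (f : MvPolynomial (Fin k) F) : ℕ :=
  Set.ncard {u : Fin k × Bool → F | Function.Injective u ∧
    Even (Set.ncard {ε : Fin k → Bool |
      ¬ IsSquare (MvPolynomial.eval (fun i => u (i, ε i)) f)})}


section Stepanov
open Polynomial

def NSq {F : Type*} [Field F] (f : F[X]) : Prop :=
  ∀ (c : F) (r s : F[X]), c ≠ 0 → r ^ 2 * f = Polynomial.C c * s ^ 2 → r = 0 ∧ s = 0

def WtB {F : Type*} [Field F] (w N : ℕ) (P : F[X][X]) : Prop :=
  ∀ j, (P.coeff j).natDegree ≤ N + w * j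

lemma WtB.mul {F : Type*} [Field F] {w N N' : ℕ} {P Q : F[X][X]} (hP : WtB w N P)
    (hQ : WtB w N' Q) : WtB w (N + N') (P * Q) := by
  intro j
  rw [Polynomial.coeff_mul]
  refine Polynomial.natDegree_sum_le_of_forall_le _ _ ?_
  rintro ⟨a, b⟩ hab
  rw [Finset.HasAntidiagonal.mem_antidiagonal] at hab
  refine (Polynomial.natDegree_mul_le).trans ?_
  have h1 := hP a
  have h2 := hQ b
  simp only at hab ⊢
  subst hab
  nlinarith

lemma WtB.one {F : Type*} [Field F] (w : ℕ) : WtB w 0 (1 : F[X][X]) := by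
  intro j
  rw [Polynomial.coeff_one]
  split_ifs <;> simp

lemma WtB.pow {F : Type*} [Field F] {w N : ℕ} {P : F[X][X]} (hP : WtB w N P) (n : ℕ) :
    WtB w (n * N) (P ^ n) := by
  induction n with
  | zero => simpa using WtB.one w
  | succ n ih => rw [pow_succ, add_mul, one_mul]; exact ih.mul hP

lemma WtB.C {F : Type*} [Field F] {w : ℕ} {P : F[X]} :
    WtB w P.natDegree (Polynomial.C P) := by
  intro j
  rw [Polynomial.coeff_C]
  split_ifs <;> simp

/-- The substitution `X ↦ Polynomial.X + T f(Polynomial.X)`. -/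
noncomputable def stPhi {F : Type*} [Field F] (f : F[X]) : F[X] →ₐ[F] F[X][X] :=
  Polynomial.aeval (Polynomial.C Polynomial.X + Polynomial.X * Polynomial.C f)

lemma stPhi_X_wt {F : Type*} [Field F] (f : F[X]) (hm : 1 ≤ f.natDegree) :
    WtB (f.natDegree - 1) 1 (stPhi f Polynomial.X) := by
  intro j
  rw [stPhi, Polynomial.aeval_X]
  rcases j with _ | _ | j
  · simp
  · simp [Polynomial.coeff_X, Polynomial.coeff_C]; omega
  · simp [Polynomial.coeff_X, Polynomial.coeff_C]

lemma stPhi_wt {F : Type*} [Field F] (f : F[X]) (hm : 1 ≤ f.natDegree) (r : F[X]) :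
    WtB (f.natDegree - 1) r.natDegree (stPhi f r) := by
  intro j
  have : stPhi f r = ∑ i ∈ Finset.range (r.natDegree + 1), r.coeff i • (stPhi f Polynomial.X) ^ i := by
    conv_lhs => rw [r.as_sum_range_C_mul_X_pow]
    simp [map_sum, Polynomial.C_mul', map_smul]
  rw [this, Polynomial.finsetSum_coeff]
  refine Polynomial.natDegree_sum_le_of_forall_le _ _ ?_
  intro i hi
  rw [Finset.mem_range] at hi
  rw [Polynomial.coeff_smul]
  refine (Polynomial.natDegree_smul_le _ _).trans ?_
  have := (stPhi_X_wt f hm).pow i j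
  omega

lemma exists_U {F : Type*} [Field F] (f : F[X]) (hm : 1 ≤ f.natDegree) :
    ∃ U : F[X][X], stPhi f f = Polynomial.C f * U ∧ WtB (f.natDegree - 1) 0 U := by
  have h1 : Polynomial.C f ∣ stPhi f f := by
    have h := Polynomial.sub_dvd_eval_sub (Polynomial.C Polynomial.X + Polynomial.X * Polynomial.C f) (Polynomial.C (Polynomial.X : F[X])) (f.map (algebraMap F F[X][X]))
    rw [Polynomial.eval_map_algebraMap, Polynomial.eval_map_algebraMap] at h
    have h2 : Polynomial.aeval (Polynomial.C (Polynomial.X : F[X])) f = Polynomial.C f := by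
      have := Polynomial.aeval_algebraMap_apply (F[X][X]) (Polynomial.X : F[X]) f
      rw [Polynomial.aeval_X_left_apply] at this
      exact this
    rw [h2, add_sub_cancel_left] at h
    have h3 := (Dvd.intro_left _ rfl : Polynomial.C f ∣ Polynomial.X * Polynomial.C f).trans h
    exact (dvd_sub_self_right).1 h3
  obtain ⟨U, hU⟩ := h1
  refine ⟨U, hU, ?_⟩
  intro j
  by_cases hj : U.coeff j = 0
  · simp [hj]
  have := stPhi_wt f hm f j
  rw [hU, Polynomial.coeff_C_mul, Polynomial.natDegree_mul _ hj] at this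
  · omega
  · rintro rfl; simp at hm

lemma st_vanish {F : Type*} [Field F] (f P : F[X]) (x : F) (hx : f.eval x ≠ 0) (l : ℕ)
    (h : (Polynomial.X : F[X]) ^ l ∣ (stPhi f P).map (Polynomial.evalRingHom x)) :
    (Polynomial.X - Polynomial.C x) ^ l ∣ P := by
  have h1 : (stPhi f P).map (Polynomial.evalRingHom x) =
      P.comp (Polynomial.C x + Polynomial.X * Polynomial.C (f.eval x)) := by
    have : (((Polynomial.mapRingHom (Polynomial.evalRingHom x)).comp (stPhi f).toRingHom)) =
        Polynomial.compRingHom (Polynomial.C x + Polynomial.X * Polynomial.C (f.eval x)) := by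
      apply Polynomial.ringHom_ext
      · intro a; simp [stPhi]
      · simp [stPhi]
    exact congrArg (fun φ => φ P) this
  obtain ⟨Q, hQ⟩ := h
  rw [h1] at hQ
  have h2 := congrArg (fun R => R.comp (Polynomial.C (f.eval x)⁻¹ * (Polynomial.X - Polynomial.C x))) hQ
  simp only [Polynomial.comp_assoc, Polynomial.mul_comp, Polynomial.pow_comp, Polynomial.X_comp, Polynomial.add_comp, Polynomial.C_comp] at h2
  have h3 : Polynomial.C x + Polynomial.C (f.eval x)⁻¹ * (Polynomial.X - Polynomial.C x) * Polynomial.C (f.eval x) = Polynomial.X := by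
    rw [mul_right_comm, ← Polynomial.C_mul, inv_mul_cancel₀ hx]; simp
  rw [h3, Polynomial.comp_X] at h2
  rw [h2, mul_pow, mul_assoc]
  exact (Dvd.intro _ rfl : _ ∣ (Polynomial.X - Polynomial.C x)^l * _).mul_left _

lemma st_indep {F : Type*} [Field F] [Fintype F] (f : F[X]) (hf : NSq f) (h0 : f.eval 0 ≠ 0)
    (n B : ℕ) (hq : Fintype.card F = 2 * n + 1) (hB : 2 * B + f.natDegree ≤ 2 * n + 2) :
    ∀ (J : ℕ) (r s : ℕ → F[X]), (∀ j, (r j).degree < B) → (∀ j, (s j).degree < B) →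
      ∑ j ∈ Finset.range J, (r j + f ^ n * s j) * Polynomial.X ^ ((2 * n + 1) * j) = 0 →
      ∀ j < J, r j = 0 ∧ s j = 0 := by
  intro J
  induction J with
  | zero => intro r s _ _ _ j hj; omega
  | succ J ih =>
    intro r s hr hs h
    rw [Finset.sum_range_succ'] at h
    have hfac : ∑ j ∈ Finset.range J, (r (j+1) + f ^ n * s (j+1)) * Polynomial.X ^ ((2 * n + 1) * (j+1)) =
      Polynomial.X ^ (2 * n + 1) * ∑ j ∈ Finset.range J, (r (j+1) + f ^ n * s (j+1)) * Polynomial.X ^ ((2 * n + 1) * j) := by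
      rw [Finset.mul_sum]
      refine Finset.sum_congr rfl fun j _ => ?_
      rw [mul_add ( 2 * n + 1), mul_one, pow_add]; ring
    rw [hfac] at h
    simp only [mul_zero, pow_zero, mul_one] at h
    have hd : (Polynomial.X : F[X]) ^ (2 * n + 1) ∣ r 0 + f ^ n * s 0 := by
      refine ⟨-∑ j ∈ Finset.range J, (r (j+1) + f ^ n * s (j+1)) * Polynomial.X ^ ((2 * n + 1) * j), ?_⟩
      linear_combination h
    have hfq : (Polynomial.X : F[X]) ^ (2 * n + 1) ∣ f ^ (2 * n + 1) - Polynomial.C (f.eval 0) := by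
      rw [← hq, ← FiniteField.expand_card f]
      have : (Polynomial.X : F[X]) ∣ f - Polynomial.C (f.eval 0) := by
        rw [Polynomial.X_dvd_iff]; simp [Polynomial.coeff_zero_eq_eval_zero]
      obtain ⟨t, ht⟩ := this
      refine ⟨Polynomial.expand F (Fintype.card F) t, ?_⟩
      have := congrArg (Polynomial.expand F (Fintype.card F)) ht
      simpa only [map_sub, map_mul, Polynomial.expand_C, Polynomial.expand_X] using this
    have hkey : (Polynomial.X : F[X]) ^ (2 * n + 1) ∣ (r 0) ^ 2 * f - Polynomial.C (f.eval 0) * (s 0) ^ 2 := by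
      have e : (r 0) ^ 2 * f - Polynomial.C (f.eval 0) * (s 0) ^ 2 =
        (r 0 + f ^ n * s 0) * ((r 0 - f ^ n * s 0) * f) + (f ^ (2 * n + 1) - Polynomial.C (f.eval 0)) * (s 0)^2 := by
        ring
      rw [e]
      exact dvd_add (hd.mul_right _) (hfq.mul_right _)
    have hz : (r 0) ^ 2 * f - Polynomial.C (f.eval 0) * (s 0) ^ 2 = 0 := by
      refine Polynomial.eq_zero_of_dvd_of_degree_lt hkey ?_
      rw [Polynomial.degree_X_pow]
      have key : ∀ (g u : F[X]), g.degree < B → u.natDegree ≤ f.natDegree →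
          (g ^ 2 * u).degree < ((2 * n + 1 : ℕ) : WithBot ℕ) := by
        intro g u hg hu
        by_cases hgu : g = 0
        · subst hgu; rw [zero_pow two_ne_zero, zero_mul, Polynomial.degree_zero]; exact WithBot.bot_lt_coe _
        have h1 : g.natDegree < B := (Polynomial.natDegree_lt_iff_degree_lt hgu).2 hg
        refine (Polynomial.degree_le_natDegree).trans_lt ?_
        have h2 : (g^2*u).natDegree ≤ 2 * g.natDegree + u.natDegree :=
          Polynomial.natDegree_mul_le.trans (by gcongr; exact Polynomial.natDegree_pow_le)
        exact_mod_cast (by omega : (g^2*u).natDegree < 2 * n + 1)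
      refine (Polynomial.degree_sub_le _ _).trans_lt (max_lt (key _ _ (hr 0) le_rfl) ?_)
      rw [mul_comm]
      exact key _ _ (hs 0) (by simp)
    have h00 := hf _ _ _ h0 (sub_eq_zero.1 hz)
    rw [h00.1, h00.2] at h
    simp only [mul_zero, add_zero] at h
    have h' := (mul_eq_zero.1 h).resolve_left (pow_ne_zero _ Polynomial.X_ne_zero)
    have := ih (fun j => r (j+1)) (fun j => s (j+1)) (fun j => hr _) (fun j => hs _) h'
    intro j hj
    rcases j with _ | j
    · exact h00
    · exact this j (by omega)

lemma NSq.deg {F : Type*} [Field F] {f : F[X]} (hf : NSq f) : 1 ≤ f.natDegree := by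
  by_contra h
  have h0 : f.natDegree = 0 := by omega
  rw [Polynomial.natDegree_eq_zero] at h0
  obtain ⟨c, rfl⟩ := h0
  by_cases hc : c = 0
  · have := hf 1 1 0 one_ne_zero (by simp [hc])
    exact one_ne_zero this.1
  · have := hf c 1 1 hc (by simp)
    exact one_ne_zero this.1

lemma st_aux {F : Type*} [Field F] [Fintype F] [DecidableEq F] (f : F[X]) (hf : NSq f)
    (h0 : f.eval 0 ≠ 0)
    (n B J l : ℕ) (hq : Fintype.card F = 2 * n + 1) (hB : 2 * B + f.natDegree ≤ 2 * n + 2)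
    (hl : l ≤ 2 * n + 1) (hcount : l * (B + J + l * f.natDegree) < 2 * J * B)
    (a : F) (ha : a ≠ 0) (hn : n ≠ 0) :
    l * (Finset.univ.filter fun x : F => (f.eval x) ^ n = a).card ≤
      B + f.natDegree * n + (2 * n + 1) * J := by
  classical
  have hm := hf.deg
  obtain ⟨U, hU, hUw⟩ := exists_U f hm
  set m := f.natDegree with hmdef
  let e : Bool × Fin J × Fin B → F[X][X] := fun i =>
    (stPhi f (Polynomial.X ^ (i.2.2 : ℕ)) * (if i.1 then Polynomial.C (Polynomial.C a) * U ^ n else 1)) *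
      Polynomial.C (Polynomial.X ^ (i.2.1 : ℕ))
  let p : Bool × Fin J × Fin B → F[X] := fun i =>
    (Polynomial.X ^ (i.2.2 : ℕ) * (if i.1 then f ^ n else 1)) * (Polynomial.X ^ (2 * n + 1)) ^ (i.2.1 : ℕ)
  have hew : ∀ i, WtB (m - 1) (i.2.2 + i.2.1) (e i) := by
    intro i
    have h1 : WtB (m - 1) (i.2.2 : ℕ) (stPhi f (Polynomial.X ^ (i.2.2 : ℕ))) := by
      simpa using stPhi_wt f hm (Polynomial.X ^ (i.2.2 : ℕ))
    have h2 : WtB (m - 1) 0 (if i.1 then Polynomial.C (Polynomial.C a) * U ^ n else 1) := by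
      split_ifs
      · have := (WtB.C (w := m - 1) (P := Polynomial.C a)).mul (hUw.pow n)
        simpa using this
      · exact WtB.one _
    have h3 : WtB (m - 1) (i.2.1 : ℕ) (Polynomial.C (Polynomial.X ^ (i.2.1 : ℕ) : F[X])) := by
      simpa using WtB.C (w := m - 1) (P := (Polynomial.X ^ (i.2.1 : ℕ) : F[X]))
    exact (h1.mul h2).mul h3
  let w : Bool × Fin J × Fin B → (Fin l × Fin (B + J + l * m) → F) := fun i t =>
    ((e i).coeff t.1).coeff t.2
  have hLI : ¬ LinearIndependent F w := by
    intro h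
    have := h.fintype_card_le_finrank
    simp at this
    nlinarith
  rw [Fintype.not_linearIndependent_iff] at hLI
  obtain ⟨v, hv, i0, hi0⟩ := hLI
  set P : F[X] := ∑ i, v i • p i with hP
  have hcoef : ∀ t < l, (∑ i, v i • e i).coeff t = 0 := by
    intro t ht
    ext u
    rw [Polynomial.finsetSum_coeff, Polynomial.finsetSum_coeff]
    by_cases hu : u < B + J + l * m
    · have := congrFun hv (⟨t, ht⟩, ⟨u, hu⟩)
      simpa [w, Finset.sum_apply] using this
    · rw [Polynomial.coeff_zero]
      refine Finset.sum_eq_zero fun i _ => ?_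
      rw [Polynomial.coeff_smul, Polynomial.coeff_smul]
      rw [Polynomial.coeff_eq_zero_of_natDegree_lt, smul_zero]
      have h1 := hew i t
      have h2 := i.2.2.isLt
      have h3 := i.2.1.isLt
      have h4 : (m - 1) * t ≤ l * m := by
        calc (m - 1) * t ≤ m * l := Nat.mul_le_mul (by omega) ht.le
          _ = l * m := mul_comm _ _
      omega
  -- P nonzero
  have hPne : P ≠ 0 := by
    intro hP0
    let cf : Bool → ℕ → F[X] := fun b j =>
      if hj : j < J then ∑ c : Fin B, Polynomial.C (v (b, ⟨j, hj⟩, c)) * Polynomial.X ^ (c : ℕ) else 0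
    have hdeg : ∀ b j, (cf b j).degree < B := by
      intro b j
      by_cases hj : j < J
      · simp only [cf, hj, dif_pos]
        refine (Polynomial.degree_sum_le _ _).trans_lt ?_
        rw [Finset.sup_lt_iff (WithBot.bot_lt_coe _)]
        intro c _
        exact (Polynomial.degree_C_mul_X_pow_le _ _).trans_lt (by exact_mod_cast c.isLt)
      · simp only [cf, hj, dif_neg, not_false_iff, Polynomial.degree_zero]
        exact WithBot.bot_lt_coe _
    have hsum : ∑ j ∈ Finset.range J, (cf false j + f ^ n * cf true j) * Polynomial.X ^ ((2 * n + 1) * j) = 0 := by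
      rw [← hP0, hP, Finset.sum_range, Fintype.sum_prod_type, Fintype.sum_bool, Fintype.sum_prod_type,
        Fintype.sum_prod_type, ← Finset.sum_add_distrib]
      refine Finset.sum_congr rfl fun j _ => ?_
      simp only [cf, j.isLt, dif_pos, p, if_true, Polynomial.smul_eq_C_mul, pow_mul,
        Finset.mul_sum, add_mul, Finset.sum_mul, Fin.eta]
      rw [add_comm]
      congr 1
      · refine Finset.sum_congr rfl fun c _ => ?_
        ring
      · refine Finset.sum_congr rfl fun c _ => ?_
        simp
        ring
    have hall := st_indep f hf h0 n B hq hB J (cf false) (cf true) (hdeg _) (hdeg _) hsum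
    obtain ⟨b, j, c⟩ := i0
    have hcf : cf b j = 0 := by
      cases b
      · exact (hall j j.isLt).1
      · exact (hall j j.isLt).2
    apply hi0
    have := congrArg (fun Q => Q.coeff c) hcf
    simp only [cf, j.isLt, dif_pos, Polynomial.finsetSum_coeff, Polynomial.coeff_C_mul_X_pow, Fin.eta,
      Polynomial.coeff_zero, Fin.val_inj] at this
    simpa using this
  have hvan : ∀ x : F, (f.eval x) ^ n = a → (Polynomial.X - Polynomial.C x) ^ l ∣ P := by
    intro x hx
    have hfx : f.eval x ≠ 0 := by
      intro h; rw [h, zero_pow hn] at hx; exact ha hx.symm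
    refine st_vanish f P x hfx l ?_
    have hE : (Polynomial.X : F[X]) ^ l ∣ (∑ i, v i • e i).map (Polynomial.evalRingHom x) := by
      rw [Polynomial.X_pow_dvd_iff]
      intro t ht
      rw [Polynomial.coeff_map, hcoef t ht, map_zero]
    set E : F[X][X] →+* F[X] := Polynomial.mapRingHom (Polynomial.evalRingHom x) with hEdef
    have hEm : ∀ Q : F[X][X], Q.map (Polynomial.evalRingHom x) = E Q := fun Q => rfl
    have hEs : ∀ (c : F) (Q : F[X][X]), E (c • Q) = Polynomial.C c * E Q := by
      intro c Q
      have : c • Q = Polynomial.C (Polynomial.C c) * Q := by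
        ext; simp
      rw [this, map_mul]; simp [E]
    rw [hEm] at hE ⊢
    have hQ : (Polynomial.X : F[X]) ^ l ∣ E (stPhi f (Polynomial.X ^ (2 * n + 1))) - Polynomial.C x := by
      obtain ⟨r, hr⟩ := FiniteField.card' F
      have h1 : E (stPhi f (Polynomial.X ^ (2 * n + 1))) = Polynomial.C x + Polynomial.X ^ (2 * n + 1) * Polynomial.C (f.eval x) := by
        rw [← hq, ← FiniteField.expand_card, Polynomial.expand_X, map_pow, map_pow]
        have : E (stPhi f Polynomial.X) = Polynomial.C x + Polynomial.X * Polynomial.C (f.eval x) := by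
          simp [E, stPhi]
        rw [this, ← FiniteField.expand_card]
        simp
      rw [h1, add_sub_cancel_left]
      exact (pow_dvd_pow _ hl).mul_right _
    have hf' : E (stPhi f (f ^ n)) = Polynomial.C a * E U ^ n := by
      rw [map_pow, hU, mul_pow, map_mul, map_pow, map_pow, ← hx]
      simp [E]
    have hmain : (Polynomial.X : F[X]) ^ l ∣ E (stPhi f P) - E (∑ i, v i • e i) := by
      rw [hP, map_sum, map_sum, map_sum, ← Finset.sum_sub_distrib]
      refine Finset.dvd_sum fun i _ => ?_
      rw [map_smul, hEs, hEs, ← mul_sub]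
      refine Dvd.dvd.mul_left ?_ _
      simp only [p, e]
      have h2 : E (stPhi f (if i.1 = true then f ^ n else 1)) =
          E (if i.1 = true then Polynomial.C (Polynomial.C a) * U ^ n else 1) := by
        split_ifs
        · rw [hf', map_mul, map_pow]; simp [E]
        · simp
      rw [map_mul, map_mul, map_mul, map_mul, map_mul, map_mul, h2, ← mul_sub]
      refine Dvd.dvd.mul_left ?_ _
      rw [map_pow (stPhi f), map_pow E, map_pow Polynomial.C, map_pow E]
      have h3 : E (Polynomial.C Polynomial.X) = Polynomial.C x := by simp [E]
      rw [h3]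
      exact hQ.trans (sub_dvd_pow_sub_pow _ _ _)
    have := dvd_add hmain hE
    rwa [sub_add_cancel] at this
  have hmul : ∀ x : F, (f.eval x) ^ n = a → l ≤ P.roots.count x := by
    intro x hx
    rw [Polynomial.count_roots, Polynomial.le_rootMultiplicity_iff hPne]
    exact hvan x hx
  have hdegP : P.natDegree ≤ B + m * n + (2 * n + 1) * J := by
    refine Polynomial.natDegree_sum_le_of_forall_le _ _ fun i _ => ?_
    refine (Polynomial.natDegree_smul_le _ _).trans ?_
    refine Polynomial.natDegree_mul_le.trans ?_
    refine Nat.add_le_add (Polynomial.natDegree_mul_le.trans (Nat.add_le_add ?_ ?_)) ?_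
    · simpa using i.2.2.isLt.le
    · split_ifs
      · refine Polynomial.natDegree_pow_le.trans ?_
        rw [mul_comm]
      · simp
    · rw [← pow_mul, Polynomial.natDegree_X_pow]
      exact Nat.mul_le_mul_left _ i.2.1.isLt.le
  refine le_trans ?_ hdegP
  refine le_trans ?_ (Polynomial.card_roots' P)
  rw [← Multiset.sum_count_eq_card (s := Finset.univ) (by simp)]
  calc l * _ = ∑ x ∈ (Finset.univ.filter fun x : F => (f.eval x) ^ n = a), l := by
        rw [Finset.sum_const, smul_eq_mul, mul_comm]
    _ ≤ ∑ x ∈ (Finset.univ.filter fun x : F => (f.eval x) ^ n = a), P.roots.count x :=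
        Finset.sum_le_sum fun x hx => hmul x (Finset.mem_filter.1 hx).2
    _ ≤ _ := Finset.sum_le_sum_of_subset (Finset.filter_subset _ _)


lemma st_bound {F : Type*} [Field F] [Fintype F] [DecidableEq F] (f : F[X]) (hf : NSq f)
    (h0 : f.eval 0 ≠ 0) (n : ℕ) (hq : Fintype.card F = 2 * n + 1)
    (hlarge : 2 * f.natDegree + 16 ≤ 2 * n + 1) (a : F) (ha : a ≠ 0) :
    2 * (Finset.univ.filter fun x : F => (f.eval x) ^ n = a).card ≤
      (2 * n + 1) + 27 * (f.natDegree + 1) * Nat.sqrt (2 * n + 1) := by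
  set m := f.natDegree with hm
  set l := Nat.sqrt (2 * n + 1) with hl
  set q := 2 * n + 1 with hqd
  have hl1 : l * l ≤ q := Nat.sqrt_le _
  have hl2 : q ≤ l * l + l + l := Nat.sqrt_le_add _
  have hl4 : 4 ≤ l := by
    by_contra h
    have : l ≤ 3 := by omega
    nlinarith
  obtain ⟨B, hB⟩ : ∃ B, B = (q - m) / 2 := ⟨_, rfl⟩
  obtain ⟨J, hJ⟩ : ∃ J, J = l / 2 + (4 * m + 4) := ⟨_, rfl⟩
  have hB4 : q ≤ 4 * B := by omega
  have hB2 : 2 * B + m ≤ q := by omega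
  have hJ1 : l + 8 * m + 7 ≤ 2 * J := by omega
  have hJ2 : 2 * J ≤ l + 8 * m + 8 := by omega
  have hcount : l * (B + J + l * m) < 2 * J * B := by
    have a1 : 2 * (l * J) ≤ q + (2 * m + 2) * q := by
      have : l * (2 * J) ≤ l * (l + 8 * m + 8) := Nat.mul_le_mul_left _ hJ2
      have : 4 * l ≤ q := by nlinarith
      nlinarith
    have a2 : (l + 8 * m + 7) * B ≤ 2 * J * B := Nat.mul_le_mul_right _ hJ1
    have a3 : l * l * m ≤ q * m := Nat.mul_le_mul_right _ hl1
    have a4 : q * m ≤ 4 * B * m := Nat.mul_le_mul_right _ hB4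
    nlinarith
  have key := st_aux f hf h0 n B J l hq (by omega) (by nlinarith) hcount a ha (by omega)
  set N := (Finset.univ.filter fun x : F => (f.eval x) ^ n = a).card
  rw [← hm, ← hqd] at key
  have k1 : l * (2 * N) ≤ l * (q + 27 * (m + 1) * l) := by
    have b1 : q ≤ 3 * (l * l) := by nlinarith
    have b2 : q * (2 * J) ≤ q * (l + 8 * m + 8) := Nat.mul_le_mul_left _ hJ2
    have b3 : (9 * m + 9) * q ≤ (9 * m + 9) * (3 * (l * l)) := Nat.mul_le_mul_left _ b1
    have b4 : 2 * (m * n) ≤ m * q := by rw [hqd]; nlinarith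
    nlinarith
  exact Nat.le_of_mul_le_mul_left k1 (by omega)

lemma weil0 {F : Type*} [Field F] [Fintype F] [DecidableEq F] (f : F[X]) (hf : NSq f)
    (h0 : f.eval 0 ≠ 0) (hodd : Odd (Fintype.card F))
    (hlarge : 2 * f.natDegree + 16 ≤ Fintype.card F) :
    |∑ x, quadraticChar F (f.eval x)| ≤
      28 * (f.natDegree + 1) * Nat.sqrt (Fintype.card F) := by
  obtain ⟨n, hn⟩ := hodd
  have hchar : ringChar F ≠ 2 := by
    intro h
    have := FiniteField.even_card_of_char_two h
    omega
  have hfne : f ≠ 0 := by rintro rfl; simp at h0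
  have hp : ∀ x : F, (quadraticChar F x : F) = x ^ n := by
    intro x
    rw [quadraticChar_eq_pow_of_char_ne_two' hchar]
    congr 1; omega
  have h11 : (1 : F) ≠ -1 := by
    intro h
    exact (Ring.neg_one_ne_one_of_char_ne_two hchar) h.symm
  have b1 := st_bound f hf h0 n hn (by omega) 1 one_ne_zero
  have b2 := st_bound f hf h0 n hn (by omega) (-1) (by simp)
  have e1 : ∀ x : F, (quadraticChar F x = 1 ↔ x ^ n = 1) := by
    intro x
    rw [← hp]
    rcases quadraticChar_isQuadratic F x with h | h | h <;> rw [h] <;> simp [h11.symm]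
  have e2 : ∀ x : F, (quadraticChar F x = -1 ↔ x ^ n = -1) := by
    intro x
    rw [← hp]
    rcases quadraticChar_isQuadratic F x with h | h | h <;> rw [h] <;> simp [h11]
  have hsum : ∑ x, quadraticChar F (f.eval x) =
      ((Finset.univ.filter fun x : F => (f.eval x) ^ n = 1).card : ℤ) -
      ((Finset.univ.filter fun x : F => (f.eval x) ^ n = -1).card : ℤ) := by
    rw [Finset.card_filter, Finset.card_filter]
    push_cast
    rw [← Finset.sum_sub_distrib]
    refine Finset.sum_congr rfl fun x _ => ?_
    simp only [← e1, ← e2]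
    rcases quadraticChar_isQuadratic F (f.eval x) with h | h | h <;> rw [h] <;> simp
  have htot : (Fintype.card F : ℤ) =
      ((Finset.univ.filter fun x : F => (f.eval x) ^ n = 1).card : ℤ) +
      ((Finset.univ.filter fun x : F => (f.eval x) ^ n = -1).card : ℤ) +
      ((Finset.univ.filter fun x : F => f.eval x = 0).card : ℤ) := by
    rw [Finset.card_filter, Finset.card_filter, Finset.card_filter, ← Finset.card_univ, Finset.card_eq_sum_ones]
    push_cast
    rw [← Finset.sum_add_distrib, ← Finset.sum_add_distrib]
    refine Finset.sum_congr rfl fun x _ => ?_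
    simp only [← e1, ← e2, ← quadraticChar_eq_zero_iff (F := F)]
    rcases quadraticChar_isQuadratic F (f.eval x) with h | h | h <;> rw [h] <;> simp
  have hz : (Finset.univ.filter fun x : F => f.eval x = 0).card ≤ f.natDegree := by
    refine le_trans ?_ (Polynomial.card_roots' f)
    refine le_trans (Finset.card_le_card ?_) (Multiset.toFinset_card_le _)
    intro x hx
    simp only [Finset.mem_filter, Finset.mem_univ, true_and] at hx
    simp [hfne, hx]
  rw [hsum]
  rw [hn] at htot ⊢
  have hs : 1 ≤ Nat.sqrt (2 * n + 1) := by
    rw [Nat.le_sqrt]; omega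
  set l := Nat.sqrt (2 * n + 1)
  have hml : f.natDegree ≤ (f.natDegree + 1) * l := by nlinarith
  rw [abs_le]
  zify at b1 b2 hz hml
  push_cast at htot
  constructor <;> nlinarith

theorem weil (D : ℕ) : ∃ K : ℕ, ∀ (F : Type) [Field F] [Fintype F] [DecidableEq F],
    Odd (Fintype.card F) → ∀ f : F[X], f.natDegree ≤ D → NSq f →
      (∑ x, quadraticChar F (f.eval x)) ^ 2 ≤ (K : ℤ) * Fintype.card F := by
  refine ⟨(28 * (D + 1)) ^ 2 + (2 * D + 16), ?_⟩
  intro F _ _ _ hodd f hfD hf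
  by_cases hlarge : 2 * D + 16 ≤ Fintype.card F
  · have hfne : f ≠ 0 := by
      rintro rfl
      have := hf 1 1 0 one_ne_zero (by simp)
      exact one_ne_zero this.1
    obtain ⟨c, hc⟩ : ∃ c, f.eval c ≠ 0 := by
      by_contra h
      push Not at h
      apply hfne
      refine Polynomial.eq_zero_of_natDegree_lt_card_of_eval_eq_zero f (Function.injective_id) (fun x => h x) ?_
      omega
    have hg : NSq (f.comp (Polynomial.X + Polynomial.C c)) := by
      intro a r s ha h
      have h2 := congrArg (fun Q => Q.comp (Polynomial.X - Polynomial.C c)) h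
      simp only [Polynomial.mul_comp, Polynomial.pow_comp, Polynomial.comp_assoc, Polynomial.C_comp,
        Polynomial.add_comp, Polynomial.X_comp, sub_add_cancel, Polynomial.comp_X] at h2
      have h3 := hf a _ _ ha h2
      have back : ∀ Q : F[X], Q.comp (Polynomial.X - Polynomial.C c) = 0 → Q = 0 := by
        intro Q hQ
        have := congrArg (fun Q => Q.comp (Polynomial.X + Polynomial.C c)) hQ
        simpa [Polynomial.comp_assoc] using this
      exact ⟨back _ h3.1, back _ h3.2⟩
    have hdeg : (f.comp (Polynomial.X + Polynomial.C c)).natDegree = f.natDegree := by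
      rw [Polynomial.natDegree_comp]; simp
    have key := weil0 _ hg (by simpa using hc) hodd (by rw [hdeg]; omega)
    have hsum : ∑ x, quadraticChar F ((f.comp (Polynomial.X + Polynomial.C c)).eval x) =
        ∑ x, quadraticChar F (f.eval x) := by
      rw [← Equiv.sum_comp (Equiv.addRight c) (fun x => quadraticChar F (f.eval x))]
      simp
    rw [hsum, hdeg] at key
    have h1 := Nat.sqrt_le (Fintype.card F)
    set l := Nat.sqrt (Fintype.card F)
    have h2 : (28 * ((f.natDegree : ℤ) + 1) * l) ≤ 28 * (D + 1) * l := by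
      have : (f.natDegree : ℤ) ≤ D := by exact_mod_cast hfD
      gcongr
    have h3 := sq_le_sq' (by linarith [neg_abs_le (∑ x, quadraticChar F (f.eval x))]) ((le_abs_self _).trans (key.trans h2))
    refine h3.trans ?_
    zify at h1
    push_cast
    have : (28 * ((D : ℤ) + 1) * l) ^ 2 = (28 * (D + 1)) ^ 2 * (l * l) := by ring
    rw [this]
    have h4 : (28 * ((D : ℤ) + 1)) ^ 2 * (l * l) ≤ (28 * (D + 1)) ^ 2 * Fintype.card F := by gcongr
    have h5 : (0 : ℤ) ≤ (2 * D + 16) * Fintype.card F := by positivity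
    nlinarith
  · have h1 : |∑ x, quadraticChar F (f.eval x)| ≤ Fintype.card F := by
      refine (Finset.abs_sum_le_sum_abs _ _).trans ?_
      rw [← Finset.card_univ, Finset.card_eq_sum_ones]
      push_cast
      refine Finset.sum_le_sum fun x _ => ?_
      rcases quadraticChar_isQuadratic F (f.eval x) with h | h | h <;> rw [h] <;> simp
    have h2 := sq_le_sq' (by linarith [neg_abs_le (∑ x, quadraticChar F (f.eval x))]) ((le_abs_self _).trans h1)
    refine h2.trans ?_
    push Not at hlarge
    zify at hlarge
    push_cast
    rw [pow_two (Fintype.card F : ℤ)]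
    refine mul_le_mul_of_nonneg_right ?_ (by positivity)
    have : (0 : ℤ) ≤ (28 * (D + 1)) ^ 2 := by positivity
    linarith
end Stepanov

section SqrtPart
open Polynomial

def WtD {F : Type*} [Field F] {n : ℕ} (d N : ℕ) (P : (MvPolynomial (Fin n) F)[X]) : Prop :=
  ∀ j, P.coeff j ≠ 0 → (P.coeff j).totalDegree + d * j ≤ N

lemma WtD.add {F : Type*} [Field F] {n : ℕ} {d N : ℕ} {P Q : (MvPolynomial (Fin n) F)[X]}
    (hP : WtD d N P) (hQ : WtD d N Q) : WtD d N (P + Q) := by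
  intro j hj
  rw [Polynomial.coeff_add] at hj ⊢
  by_cases h1 : P.coeff j = 0
  · rw [h1, zero_add] at hj ⊢; exact hQ j hj
  by_cases h2 : Q.coeff j = 0
  · rw [h2, add_zero] at hj ⊢; exact hP j hj
  have := MvPolynomial.totalDegree_add (P.coeff j) (Q.coeff j)
  have a1 := hP j h1
  have a2 := hQ j h2
  rcases le_max_iff.1 this with h | h <;> omega

lemma WtD.neg {F : Type*} [Field F] {n : ℕ} {d N : ℕ} {P : (MvPolynomial (Fin n) F)[X]}
    (hP : WtD d N P) : WtD d N (-P) := by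
  intro j hj
  rw [Polynomial.coeff_neg] at hj ⊢
  rw [MvPolynomial.totalDegree_neg]
  exact hP j (by simpa using hj)

lemma WtD.mul {F : Type*} [Field F] {n : ℕ} {d N N' : ℕ} {P Q : (MvPolynomial (Fin n) F)[X]}
    (hP : WtD d N P) (hQ : WtD d N' Q) : WtD d (N + N') (P * Q) := by
  intro j hj
  rw [Polynomial.coeff_mul] at hj ⊢
  obtain ⟨⟨a, b⟩, hab, hne⟩ := Finset.exists_ne_zero_of_sum_ne_zero hj
  have hdj : d * j ≤ N + N' := by
    rw [Finset.HasAntidiagonal.mem_antidiagonal] at hab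
    have a1 := hP a (left_ne_zero_of_mul hne)
    have a2 := hQ b (right_ne_zero_of_mul hne)
    simp only at hab
    subst hab
    nlinarith
  suffices h : (∑ x ∈ Finset.HasAntidiagonal.antidiagonal j, P.coeff x.1 * Q.coeff x.2).totalDegree ≤ N + N' - d * j by omega
  refine MvPolynomial.totalDegree_finsetSum_le ?_
  rintro ⟨a, b⟩ hab
  rw [Finset.HasAntidiagonal.mem_antidiagonal] at hab
  by_cases h1 : P.coeff a = 0
  · simp [h1]
  by_cases h2 : Q.coeff b = 0
  · simp [h2]
  refine (MvPolynomial.totalDegree_mul _ _).trans ?_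
  have a1 := hP a h1
  have a2 := hQ b h2
  simp only at hab ⊢
  subst hab
  rw [mul_add] at hdj ⊢
  omega

lemma WtD.monomial {F : Type*} [Field F] {n : ℕ} {d N t : ℕ} {c : MvPolynomial (Fin n) F}
    (hc : c ≠ 0 → c.totalDegree + d * t ≤ N) :
    WtD d N (Polynomial.C c * Polynomial.X ^ t) := by
  intro j hj
  rw [Polynomial.coeff_C_mul_X_pow] at hj ⊢
  split_ifs at hj ⊢ with h
  · subst h; exact hc hj
  · exact absurd rfl hj

lemma exists_sqrt {F : Type*} [Field F] (h2 : (2 : F) ≠ 0) {n d N : ℕ}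
    (P : (MvPolynomial (Fin n) F)[X]) (hP : P.Monic) (hdeg : P.natDegree = 2 * N)
    (hw : WtD d (2 * N * d) P) (i : ℕ) (hi : i ≤ N) :
    ∃ g : (MvPolynomial (Fin n) F)[X], g.Monic ∧ g.natDegree = N ∧ WtD d (N * d) g ∧
      ∀ j, 2 * N - i ≤ j → (P - g ^ 2).coeff j = 0 := by
  induction i with
  | zero =>
    refine ⟨Polynomial.X ^ N, Polynomial.monic_X_pow _, Polynomial.natDegree_X_pow _, ?_, ?_⟩
    · have := WtD.monomial (F := F) (n := n) (d := d) (N := N * d) (t := N) (c := 1) (by simp [mul_comm])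
      simpa using this
    · intro j hj
      rw [← pow_mul, Polynomial.coeff_sub, Polynomial.coeff_X_pow]
      split_ifs with h
      · have h' : j = P.natDegree := by omega
        rw [h', hP.coeff_natDegree, sub_self]
      · rw [sub_zero]
        exact Polynomial.coeff_eq_zero_of_natDegree_lt (by omega)
  | succ i ih =>
    obtain ⟨g, hg, hgd, hgw, hc⟩ := ih (by omega)
    obtain ⟨t, ht⟩ : ∃ t, t + i + 1 = N := ⟨N - i - 1, by omega⟩
    set c := (P - g ^ 2).coeff (N + t) with hcdef
    have hcw : c ≠ 0 → c.totalDegree + d * t ≤ N * d := by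
      intro hc0
      have hw2 : WtD d (2 * N * d) (P - g ^ 2) := by
        rw [sub_eq_add_neg]
        refine hw.add (WtD.neg ?_)
        have := hgw.mul hgw
        rw [pow_two]
        convert this using 1
        ring
      have := hw2 _ hc0
      rw [← hcdef] at this
      nlinarith
    set b := MvPolynomial.C (2 : F)⁻¹ * c with hb
    have hb2 : b + b = c := by
      rw [hb, ← two_mul, ← mul_assoc]
      have : (2 : MvPolynomial (Fin n) F) = MvPolynomial.C 2 := (map_ofNat MvPolynomial.C 2).symm
      rw [this, ← MvPolynomial.C_mul, mul_inv_cancel₀ h2]; simp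
    have hlt : (Polynomial.C b * Polynomial.X ^ t).degree < g.degree := by
      rw [Polynomial.degree_eq_natDegree hg.ne_zero, hgd]
      exact (Polynomial.degree_C_mul_X_pow_le _ _).trans_lt (by exact_mod_cast (by omega : t < N))
    refine ⟨g + Polynomial.C b * Polynomial.X ^ t, hg.add_of_left hlt, ?_, ?_, ?_⟩
    · rw [Polynomial.natDegree_add_eq_left_of_degree_lt hlt, hgd]
    · refine hgw.add (WtD.monomial ?_)
      intro hb0
      have : c ≠ 0 := by rintro h; simp [hb, h] at hb0
      have h1 := hcw this
      have h3 := MvPolynomial.totalDegree_mul (MvPolynomial.C (2 : F)⁻¹) c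
      rw [MvPolynomial.totalDegree_C, ← hb] at h3
      omega
    · intro j hj
      have e : P - (g + Polynomial.C b * Polynomial.X ^ t) ^ 2 =
          (P - g ^ 2) - Polynomial.C c * (g * Polynomial.X ^ t) - Polynomial.C (b ^ 2) * Polynomial.X ^ (2 * t) := by
        rw [← hb2]; simp only [Polynomial.C_add, Polynomial.C_pow]; ring
      rw [e, Polynomial.coeff_sub, Polynomial.coeff_sub, Polynomial.coeff_C_mul, Polynomial.coeff_C_mul_X_pow,
        if_neg (by omega), sub_zero, Polynomial.coeff_mul_X_pow', if_pos (by omega)]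
      by_cases hjt : j = N + t
      · subst hjt
        rw [Nat.add_sub_cancel]
        have : g.coeff N = 1 := by rw [← hgd]; exact hg.coeff_natDegree
        rw [this, mul_one, sub_self]
      · rw [hc j (by omega), Polynomial.coeff_eq_zero_of_natDegree_lt (by omega : g.natDegree < j - t)]
        simp

/-- over an algebraically closed field, a monic constant multiple of a square agrees with the
approximate square root. -/
lemma sqrt_unique {L : Type*} [Field L] [IsAlgClosed L] (h2 : (2 : L) ≠ 0) (P g h : L[X]) (c : L)
    (hP : P.Monic) (N : ℕ) (hdeg : P.natDegree = 2 * N) (hg : g.Monic) (hgd : g.natDegree = N)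
    (hj : ∀ j, N ≤ j → (P - g ^ 2).coeff j = 0) (hc : P = Polynomial.C c * h ^ 2) :
    P = g ^ 2 := by
  obtain ⟨e, he⟩ := IsAlgClosed.exists_pow_nat_eq c (n := 2) (by norm_num)
  set G := Polynomial.C e * h with hG
  have hPG : P = G ^ 2 := by rw [hc, hG, mul_pow, ← Polynomial.C_pow, he]
  have main : ∀ G : L[X], P = G ^ 2 → G.leadingCoeff = 1 → P = g ^ 2 := by
    intro G hPG hl
    have hGd : G.natDegree = N := by
      have := Polynomial.natDegree_pow G 2
      rw [← hPG, hdeg] at this; omega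
    have hco : (G + g).coeff N = 2 := by
      rw [Polynomial.coeff_add, ← hgd, hg.coeff_natDegree, hgd, ← hGd]
      change G.leadingCoeff + 1 = 2
      rw [hl]; norm_num
    by_contra hne
    have hD : P - g ^ 2 ≠ 0 := sub_ne_zero.2 hne
    have hfac : P - g ^ 2 = (G + g) * (G - g) := by rw [hPG]; ring
    have h1 : N ≤ (G + g).natDegree := Polynomial.le_natDegree_of_ne_zero (by rw [hco]; exact h2)
    have h3 : N ≤ (P - g ^ 2).natDegree := by
      rw [hfac] at hD ⊢
      rw [Polynomial.natDegree_mul (left_ne_zero_of_mul hD) (right_ne_zero_of_mul hD)]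
      omega
    have := hj _ h3
    rw [Polynomial.coeff_natDegree, Polynomial.leadingCoeff_eq_zero] at this
    exact hD this
  have hl : G.leadingCoeff ^ 2 = 1 := by
    rw [← Polynomial.leadingCoeff_pow, ← hPG]; exact hP
  rcases sq_eq_sq_iff_eq_or_eq_neg.1 (hl.trans (one_pow 2).symm) with h | h
  · exact main G hPG h
  · exact main (-G) (by rw [hPG]; ring) (by rw [Polynomial.leadingCoeff_neg, h, neg_neg])

lemma exists_sqfree {R : Type*} [CommRing R] [IsDomain R] [UniqueFactorizationMonoid R] (x : R)
    (hx : x ≠ 0) : ∃ a b : R, x = a * b ^ 2 ∧ Squarefree a := by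
  revert hx
  refine UniqueFactorizationMonoid.induction_on_prime x (fun h => absurd rfl h) ?_ ?_
  · intro u hu _
    exact ⟨u, 1, by simp, hu.squarefree⟩
  · intro a p ha hp ih _
    obtain ⟨s, b, hs, hsq⟩ := ih ha
    by_cases hps : p ∣ s
    · obtain ⟨t, rfl⟩ := hps
      exact ⟨t, p * b, by rw [hs]; ring, hsq.of_mul_right⟩
    · refine ⟨p * s, b, by rw [hs]; ring, ?_⟩
      rw [squarefree_mul_iff]
      exact ⟨(hp.irreducible.isRelPrime_iff_not_dvd).2 hps, hp.irreducible.squarefree, hsq⟩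

lemma sym_square {F : Type*} [Field F] {n : ℕ} (f : MvPolynomial (Fin (n + 1)) F) (hf : f ≠ 0)
    (hs : f.IsSymmetric) (A G : MvPolynomial (Fin (n + 1)) F) (hA : A ≠ 0)
    (hA0 : A.degreeOf 0 = 0) (h : f * A = G ^ 2) :
    ∃ (c : F) (g : MvPolynomial (Fin (n + 1)) F), f = MvPolynomial.C c * g ^ 2 := by
  obtain ⟨a, b, hab, hsq⟩ := exists_sqfree f hf
  have ha : a ≠ 0 := by rintro rfl; simp at hab; exact hf hab
  have hb : b ≠ 0 := by rintro rfl; simp at hab; exact hf hab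
  have key : ∀ A G : MvPolynomial (Fin (n + 1)) F, f * A = G ^ 2 → ∀ p, Prime p → p ∣ a → p ∣ A := by
    intro A G h p hp hpa
    have h1 : b ^ 2 ∣ G ^ 2 := ⟨a * A, by rw [← h, hab]; ring⟩
    obtain ⟨H, rfl⟩ := (IsIntegrallyClosed.pow_dvd_pow_iff two_ne_zero).1 h1
    have h2 : a * A = H ^ 2 := by
      have : b ^ 2 * (a * A) = b ^ 2 * H ^ 2 := by
        rw [hab] at h; linear_combination h
      exact mul_left_cancel₀ (pow_ne_zero 2 hb) this
    have h3 : p ∣ H := hp.dvd_of_dvd_pow (h2 ▸ hpa.mul_right A)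
    obtain ⟨t, rfl⟩ := hpa
    obtain ⟨u, rfl⟩ := h3
    have h4 : t * A = p * u ^ 2 := by
      refine mul_left_cancel₀ hp.ne_zero ?_
      linear_combination h2
    rcases hp.dvd_or_dvd (Dvd.intro _ h4.symm) with h5 | h5
    · obtain ⟨w, rfl⟩ := h5
      exact absurd (hsq p ⟨w, by ring⟩) hp.not_unit
    · exact h5
  have hu : IsUnit a := by
    by_contra hau
    obtain ⟨p, hp, hpa⟩ := WfDvdMonoid.exists_irreducible_factor hau ha
    have hpp := UniqueFactorizationMonoid.irreducible_iff_prime.1 hp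
    have hdeg : ∀ i, p.degreeOf i = 0 := by
      intro i
      have h1 : f * rename (Equiv.swap 0 i) A = (rename (Equiv.swap 0 i) G) ^ 2 := by
        rw [← map_pow, ← h, map_mul, hs]
      obtain ⟨w, hw⟩ := key _ _ h1 p hpp hpa
      have hne : rename (Equiv.swap 0 i) A ≠ 0 := by
        intro h0
        exact hA ((rename_injective _ (Equiv.injective _)) (by rw [h0, map_zero]))
      have h2 : (rename (Equiv.swap 0 i) A).degreeOf i = 0 := by
        have := MvPolynomial.degreeOf_rename_of_injective (p := A) (Equiv.swap 0 i).injective 0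
        rw [Equiv.swap_apply_left] at this
        rw [this, hA0]
      rw [hw] at hne h2
      rw [MvPolynomial.degreeOf_mul_eq (left_ne_zero_of_mul hne) (right_ne_zero_of_mul hne)] at h2
      omega
    have h0 : p.totalDegree = 0 := by
      rw [MvPolynomial.totalDegree_eq_zero_iff]
      intro m hm x
      have := MvPolynomial.monomial_le_degreeOf x hm
      rw [hdeg] at this; omega
    rw [MvPolynomial.totalDegree_eq_zero_iff_eq_C] at h0
    apply hp.not_isUnit
    rw [h0]
    refine IsUnit.map _ (IsUnit.mk0 _ ?_)
    intro hz
    rw [hz, MvPolynomial.C_0] at h0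
    exact hp.ne_zero h0
  obtain ⟨c, -, hc⟩ := MvPolynomial.isUnit_iff_eq_C_of_isReduced.1 hu
  exact ⟨c, b, by rw [hab, hc]⟩


lemma sz_count {F : Type*} [Field F] [Fintype F] [DecidableEq F] {n : ℕ}
    (P : MvPolynomial (Fin n) F) (hP : P ≠ 0) :
    (Finset.univ.filter fun y : Fin n → F => MvPolynomial.eval y P = 0).card * Fintype.card F ≤
      P.totalDegree * Fintype.card F ^ n := by
  have h := MvPolynomial.schwartz_zippel_totalDegree hP (Finset.univ : Finset F)
  rw [Fintype.piFinset_univ, Finset.card_univ] at h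
  have hq : (0 : ℚ≥0) < Fintype.card F := by exact_mod_cast Fintype.card_pos
  rw [div_le_div_iff₀ (pow_pos hq n) hq] at h
  exact_mod_cast h

lemma few_bad {F : Type*} [Field F] [Fintype F] [DecidableEq F] (h2 : (2 : F) ≠ 0) {n d : ℕ}
    (f : MvPolynomial (Fin (n + 1)) F) (hs : f.IsSymmetric) (hd : f.totalDegree ≤ d)
    (hns : ¬ ∃ (c : F) (g : MvPolynomial (Fin (n + 1)) F), f = MvPolynomial.C c * g ^ 2) :
    ∃ Q : MvPolynomial (Fin n) F, Q ≠ 0 ∧ Q.totalDegree ≤ d + d * d ∧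
      ∀ y : Fin n → F, (∃ (c : AlgebraicClosure F) (h : (AlgebraicClosure F)[X]),
        ((finSuccEquiv F n f).map (MvPolynomial.eval y)).map (algebraMap F (AlgebraicClosure F)) =
          Polynomial.C c * h ^ 2) → MvPolynomial.eval y Q = 0 := by
  have hf : f ≠ 0 := by rintro rfl; exact hns ⟨0, 0, by simp⟩
  set p := finSuccEquiv F n f with hp
  have hp0 : p ≠ 0 := by rw [hp]; simpa using hf
  set a := p.leadingCoeff with ha
  have ha0 : a ≠ 0 := by simpa [ha] using hp0
  have hpw : ∀ j, p.coeff j ≠ 0 → (p.coeff j).totalDegree ≤ d := by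
    intro j hj
    have := MvPolynomial.totalDegree_coeff_finSuccEquiv_add_le f j hj
    rw [← hp] at this
    omega
  have had : a.totalDegree ≤ d := hpw _ ha0
  set m := p.natDegree with hm
  have hmd : m ≤ d := by
    rw [hm, hp, MvPolynomial.natDegree_finSuccEquiv]
    exact (MvPolynomial.degreeOf_le_totalDegree f 0).trans hd
  have hm1 : 1 ≤ m := by
    by_contra hm0
    have h0 : f.degreeOf 0 = 0 := by
      rw [← MvPolynomial.natDegree_finSuccEquiv, ← hp, ← hm]; omega
    have hall : ∀ i, f.degreeOf i = 0 := by
      intro i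
      have := MvPolynomial.degreeOf_rename_of_injective (p := f) (Equiv.swap 0 i).injective 0
      rw [Equiv.swap_apply_left, hs] at this
      rw [this, h0]
    have ht : f.totalDegree = 0 := by
      rw [MvPolynomial.totalDegree_eq_zero_iff]
      intro m hm x
      have := MvPolynomial.monomial_le_degreeOf x hm
      rw [hall] at this; omega
    rw [MvPolynomial.totalDegree_eq_zero_iff_eq_C] at ht
    exact hns ⟨_, 1, by rw [one_pow, mul_one]; exact ht⟩
  -- behaviour at a bad point
  have hbad : ∀ y : Fin n → F, MvPolynomial.eval y a ≠ 0 → ∀ (c : AlgebraicClosure F) (h : (AlgebraicClosure F)[X]),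
        (p.map (MvPolynomial.eval y)).map (algebraMap F (AlgebraicClosure F)) =
          Polynomial.C c * h ^ 2 → m = 2 * h.natDegree ∧ ∃ (c' : AlgebraicClosure F) (h' : (AlgebraicClosure F)[X]),
        (p.integralNormalization.map (MvPolynomial.eval y)).map (algebraMap F (AlgebraicClosure F)) = Polynomial.C c' * h' ^ 2 := by
    intro y hy c h hch
    rw [Polynomial.map_map] at hch
    have hy' : ((algebraMap F (AlgebraicClosure F)).comp (MvPolynomial.eval y)) p.leadingCoeff ≠ 0 := by
      simpa using hy
    have hne : p.map ((algebraMap F (AlgebraicClosure F)).comp (MvPolynomial.eval y)) ≠ 0 := by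
      intro h0
      have := Polynomial.leadingCoeff_map_of_leadingCoeff_ne_zero _ hy'
      rw [h0, Polynomial.leadingCoeff_zero] at this
      exact hy' this.symm
    have hnd : (p.map ((algebraMap F (AlgebraicClosure F)).comp (MvPolynomial.eval y))).natDegree = m :=
      Polynomial.natDegree_map_of_leadingCoeff_ne_zero _ hy'
    constructor
    · rw [hch] at hnd hne
      have hc0 := Polynomial.C_ne_zero.1 (left_ne_zero_of_mul hne)
      rw [Polynomial.natDegree_C_mul hc0, Polynomial.natDegree_pow] at hnd
      exact hnd.symm
    · rw [Polynomial.map_map, ← Polynomial.integralNormalization_map _ _ hy']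
      have h1 := Polynomial.integralNormalization_mul_C_leadingCoeff (p.map ((algebraMap F (AlgebraicClosure F)).comp (MvPolynomial.eval y)))
      set P := p.map ((algebraMap F (AlgebraicClosure F)).comp (MvPolynomial.eval y)) with hPdef
      have hl0 : P.leadingCoeff ≠ 0 := Polynomial.leadingCoeff_ne_zero.2 hne
      set b := P.leadingCoeff
      have h3 : P.scaleRoots b = Polynomial.C c * (h.scaleRoots b) ^ 2 := by
        rw [hch, Polynomial.mul_scaleRoots_of_noZeroDivisors, pow_two, Polynomial.mul_scaleRoots_of_noZeroDivisors, pow_two, Polynomial.scaleRoots_C]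
      refine ⟨c * b⁻¹, h.scaleRoots b, ?_⟩
      rw [h3] at h1
      rw [Polynomial.C_mul, mul_right_comm, ← h1, mul_assoc, ← Polynomial.C_mul, mul_inv_cancel₀ hl0]
      simp
  rcases Nat.even_or_odd m with hev | hod
  swap
  · refine ⟨a, ha0, by omega, ?_⟩
    rintro y ⟨c, h, hch⟩
    by_contra hy
    obtain ⟨h1, -⟩ := hbad y hy c h hch
    rw [h1] at hod
    exact (Nat.not_odd_iff_even.2 (even_two_mul _)) hod
  obtain ⟨N, hN⟩ := hev
  have hN2 : m = 2 * N := by omega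
  have hInd : p.integralNormalization.natDegree = 2 * N := by
    rw [Polynomial.natDegree_integralNormalization, ← hm, hN2]
  have hImon := Polynomial.monic_integralNormalization hp0
  have hIw : WtD d (2 * N * d) p.integralNormalization := by
    intro j hj
    by_cases hjm : j = m
    · have : p.integralNormalization.coeff j = 1 := by
        rw [hjm]; exact Polynomial.integralNormalization_coeff_natDegree hp0
      rw [this, MvPolynomial.totalDegree_one, hjm, hN2, zero_add, mul_comm]
    · have hjl : j < m := by
        have := Polynomial.le_natDegree_of_ne_zero hj
        rw [hInd] at this; omega
      rw [Polynomial.integralNormalization_coeff_ne_natDegree hjm] at hj ⊢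
      have h1 := hpw j (left_ne_zero_of_mul hj)
      have h3 := MvPolynomial.totalDegree_mul (p.coeff j) (p.leadingCoeff ^ (p.natDegree - 1 - j))
      have h4 := MvPolynomial.totalDegree_pow p.leadingCoeff (p.natDegree - 1 - j)
      have h5 : (p.natDegree - 1 - j) * a.totalDegree ≤ (p.natDegree - 1 - j) * d := Nat.mul_le_mul_left _ had
      rw [← hN2]
      obtain ⟨t, ht⟩ : ∃ t, m = j + 1 + t := ⟨m - j - 1, by omega⟩
      have ht' : p.natDegree - 1 - j = t := by omega
      rw [ht'] at h3 h4 h5 ⊢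
      rw [ht]
      nlinarith
  obtain ⟨g, hg, hgd, hgw, hgc⟩ := exists_sqrt h2 p.integralNormalization hImon hInd hIw N le_rfl
  have hD : p.integralNormalization - g ^ 2 ≠ 0 := by
    intro h0
    have h1 := Polynomial.integralNormalization_eval₂_leadingCoeff_mul (p := p) hm1 Polynomial.C Polynomial.X
    rw [sub_eq_zero.1 h0, Polynomial.eval₂_C_X, Polynomial.eval₂_pow] at h1
    have h3 := congrArg (finSuccEquiv F n).symm h1
    rw [map_pow, map_mul, map_pow, hp, AlgEquiv.symm_apply_apply] at h3
    rw [← hp] at h3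
    apply hns
    refine sym_square f hf hs (((finSuccEquiv F n).symm (Polynomial.C p.leadingCoeff)) ^ (p.natDegree - 1)) _ ?_ ?_ ((mul_comm _ _).trans h3.symm)
    · apply pow_ne_zero
      simpa using hp0
    · rw [← MvPolynomial.natDegree_finSuccEquiv, map_pow, AlgEquiv.apply_symm_apply, ← Polynomial.C_pow, Polynomial.natDegree_C]
  obtain ⟨j, hj⟩ : ∃ j, (p.integralNormalization - g ^ 2).coeff j ≠ 0 := by
    by_contra h
    push Not at h
    exact hD (Polynomial.ext (by simpa using h))
  refine ⟨a * (p.integralNormalization - g ^ 2).coeff j, mul_ne_zero ha0 hj, ?_, ?_⟩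
  · refine (MvPolynomial.totalDegree_mul _ _).trans (Nat.add_le_add had ?_)
    have hw2 : WtD d (2 * N * d) (p.integralNormalization - g ^ 2) := by
      rw [sub_eq_add_neg]
      refine hIw.add (WtD.neg ?_)
      have := hgw.mul hgw
      rw [pow_two]
      convert this using 1
      ring
    have := hw2 j hj
    have h3 : 2 * N * d ≤ d * d := Nat.mul_le_mul_right _ (by omega)
    omega
  · rintro y ⟨c, h, hch⟩
    rw [map_mul]
    by_cases hy : MvPolynomial.eval y a = 0
    · rw [hy, zero_mul]
    obtain ⟨-, c', h', hc'⟩ := hbad y hy c h hch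
    have hL2 : (2 : AlgebraicClosure F) ≠ 0 := by
      intro h0
      apply h2
      apply (algebraMap F (AlgebraicClosure F)).injective
      rw [map_zero, map_ofNat, h0]
    rw [Polynomial.map_map] at hc'
    set φ := (algebraMap F (AlgebraicClosure F)).comp (MvPolynomial.eval y) with hφ
    have key := sqrt_unique hL2 (p.integralNormalization.map φ) (g.map φ) h' c' (hImon.map _) N
      (by rw [hImon.natDegree_map, hInd]) (hg.map _) (by rw [hg.natDegree_map, hgd])
      (by
        intro i hi
        rw [← Polynomial.map_pow, ← Polynomial.map_sub, Polynomial.coeff_map, hgc i (by omega), map_zero]) hc'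
    have h5 : (p.integralNormalization - g ^ 2).map φ = 0 := by
      rw [Polynomial.map_sub, Polynomial.map_pow, key, sub_self]
    have h6 := congrArg (fun P => P.coeff j) h5
    simp only [Polynomial.coeff_map, Polynomial.coeff_zero, hφ, RingHom.comp_apply] at h6
    have h7 : MvPolynomial.eval y ((p.integralNormalization - g ^ 2).coeff j) = 0 := by
      apply (algebraMap F (AlgebraicClosure F)).injective
      rw [h6, map_zero]
    rw [h7, mul_zero]

lemma even_mult_square {L : Type*} [Field L] [IsAlgClosed L] (P : L[X])
    (h : ∀ a, ¬ Odd (P.rootMultiplicity a)) : ∃ (c : L) (g : L[X]), P = Polynomial.C c * g ^ 2 := by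
  classical
  refine ⟨P.leadingCoeff, ∏ a ∈ P.roots.toFinset, (Polynomial.X - Polynomial.C a) ^ (P.rootMultiplicity a / 2), ?_⟩
  have h1 := (IsAlgClosed.splits P).eq_prod_roots
  conv_lhs => rw [h1]
  rw [Polynomial.prod_multiset_root_eq_finset_root, ← Finset.prod_pow]
  congr 1
  refine Finset.prod_congr rfl fun a _ => ?_
  rw [← pow_mul]
  congr 1
  have := Nat.not_odd_iff_even.1 (h a)
  exact (Nat.div_mul_cancel this.two_dvd).symm

lemma NSq_of_odd {F L : Type*} [Field F] [Field L] [Algebra F L] (P : F[X]) (α : L)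
    (h : Odd ((P.map (algebraMap F L)).rootMultiplicity α)) : NSq P := by
  intro c r s hc hrs
  have hP : P ≠ 0 := by rintro rfl; simp at h
  by_cases hr : r = 0
  · subst hr
    simp [hc] at hrs
    exact ⟨rfl, hrs⟩
  exfalso
  have hs : s ≠ 0 := by
    rintro rfl
    simp [hr, hP] at hrs
  have h1 := congrArg (fun Q => (Polynomial.map (algebraMap F L) Q).rootMultiplicity α) hrs
  have inj := (algebraMap F L).injective
  have hr' := (Polynomial.map_ne_zero_iff inj).2 hr
  have hs' := (Polynomial.map_ne_zero_iff inj).2 hs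
  have hP' := (Polynomial.map_ne_zero_iff inj).2 hP
  have hc' : (Polynomial.C (algebraMap F L c)) ≠ 0 := by simpa using hc
  simp only [Polynomial.map_mul, Polynomial.map_pow, Polynomial.map_C] at h1
  rw [Polynomial.rootMultiplicity_mul (mul_ne_zero (pow_ne_zero _ hr') hP'),
    Polynomial.rootMultiplicity_mul (mul_ne_zero hc' (pow_ne_zero _ hs')), Polynomial.rootMultiplicity_C,
    pow_two, pow_two, Polynomial.rootMultiplicity_mul (mul_ne_zero hr' hr'),
    Polynomial.rootMultiplicity_mul (mul_ne_zero hs' hs')] at h1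
  obtain ⟨t, ht⟩ := h
  omega
end SqrtPart

section Assembly

lemma substX_eq {L : Type*} [Field L] {n : ℕ} (f : MvPolynomial (Fin (n + 1)) L) (v : Fin n → L) :
    substX f v = (finSuccEquiv L n f).map (MvPolynomial.eval v) := by
  unfold substX
  induction f using MvPolynomial.induction_on with
  | C a => simp [finSuccEquiv_apply]
  | add p q hp hq => rw [map_add, map_add, Polynomial.map_add, hp, hq]
  | mul_X p i hp =>
    rw [map_mul, map_mul, Polynomial.map_mul, hp]
    congr 1
    refine Fin.cases ?_ (fun j => ?_) i
    · simp [finSuccEquiv_X_zero]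
    · simp [finSuccEquiv_X_succ]

lemma substX_map {F L : Type*} [Field F] [Field L] (φ : F →+* L) {n : ℕ} (f : MvPolynomial (Fin (n + 1)) F) (v : Fin n → F) :
    (substX f v).map φ = substX (MvPolynomial.map φ f) (fun j => φ (v j)) := by
  unfold substX
  induction f using MvPolynomial.induction_on with
  | C a => simp
  | add p q hp hq => rw [map_add, map_add, Polynomial.map_add, map_add, hp, hq]
  | mul_X p i hp =>
    rw [map_mul, map_mul, Polynomial.map_mul, map_mul, hp]
    congr 1
    refine Fin.cases ?_ (fun j => ?_) i
    · simp
    · simp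

lemma line_roots {F : Type*} [Field F] [Fintype F] [DecidableEq F] {n d : ℕ}
    (f : MvPolynomial (Fin (n + 1)) F) (hs : f.IsSymmetric) (hd : f.totalDegree ≤ d)
    (hadm : Admissible f) [DecidableEq (AlgebraicClosure F)] (w : Fin (n + 1) → AlgebraicClosure F) (i : Fin (n + 1)) :
    (Finset.univ.filter fun t : F => MvPolynomial.eval
      (Function.update w i (algebraMap F (AlgebraicClosure F) t))
      (MvPolynomial.map (algebraMap F (AlgebraicClosure F)) f) = 0).card ≤ d := by
  classical
  set f' := MvPolynomial.map (algebraMap F (AlgebraicClosure F)) f with hf'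
  have hs' : f'.IsSymmetric := hs.map _
  set v : Fin n → AlgebraicClosure F := fun j => w (Equiv.swap 0 i j.succ) with hv
  have hne := hadm.2 v
  rw [← hf', substX_eq] at hne
  set P := (finSuccEquiv (AlgebraicClosure F) n f').map (MvPolynomial.eval v) with hP
  have hPd : P.natDegree ≤ d := by
    refine Polynomial.natDegree_map_le.trans ?_
    rw [MvPolynomial.natDegree_finSuccEquiv]
    refine (MvPolynomial.degreeOf_le_totalDegree f' 0).trans (le_trans ?_ hd)
    exact Finset.sup_mono (MvPolynomial.support_map_subset _ _)
  have heval : ∀ t : AlgebraicClosure F, MvPolynomial.eval (Function.update w i t) f' = P.eval t := by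
    intro t
    rw [hP, ← MvPolynomial.eval_eq_eval_mv_eval']
    rw [← hs' (Equiv.swap 0 i), MvPolynomial.eval_rename, hs']
    congr 2
    funext j
    refine Fin.cases ?_ (fun j => ?_) j
    · simp
    · have : Equiv.swap 0 i j.succ ≠ i := by
        intro h
        have h2 := congrArg (Equiv.swap 0 i) h
        simp at h2
      simp [hv, this]
  calc _ = ((Finset.univ.filter fun t : F => MvPolynomial.eval
      (Function.update w i (algebraMap F (AlgebraicClosure F) t)) f' = 0).image
        (algebraMap F (AlgebraicClosure F))).card :=
        (Finset.card_image_of_injective _ (algebraMap F (AlgebraicClosure F)).injective).symm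
    _ ≤ P.roots.toFinset.card := by
      apply Finset.card_le_card
      intro t ht
      simp only [Finset.mem_image, Finset.mem_filter, Finset.mem_univ, true_and] at ht
      obtain ⟨a, ha, rfl⟩ := ht
      rw [Multiset.mem_toFinset, Polynomial.mem_roots hne, Polynomial.IsRoot, ← heval, ha]
    _ ≤ d := (Multiset.toFinset_card_le _).trans ((Polynomial.card_roots' _).trans hPd)

lemma line_roots' {F : Type*} [Field F] [Fintype F] [DecidableEq F] {n d : ℕ}
    (f : MvPolynomial (Fin (n + 1)) F) (hs : f.IsSymmetric) (hd : f.totalDegree ≤ d)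
    (hadm : Admissible f) (w : Fin (n + 1) → F) (i : Fin (n + 1)) :
    (Finset.univ.filter fun t : F => MvPolynomial.eval (Function.update w i t) f = 0).card ≤ d := by
  classical
  refine le_trans (Finset.card_le_card ?_) (line_roots f hs hd hadm (algebraMap F (AlgebraicClosure F) ∘ w) i)
  intro t ht
  simp only [Finset.mem_filter, Finset.mem_univ, true_and] at ht ⊢
  rw [← Function.comp_update, ← MvPolynomial.map_eval, ht, map_zero]

lemma fiber_count {ι F : Type*} [Fintype ι] [DecidableEq ι] [Fintype F] [DecidableEq F] (i : ι)
    (p : (ι → F) → Prop) [DecidablePred p] (D : ℕ)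
    (h : ∀ u, (Finset.univ.filter fun t : F => p (Function.update u i t)).card ≤ D) :
    (Finset.univ.filter p).card * Fintype.card F ≤ D * Fintype.card F ^ Fintype.card ι := by
  calc (Finset.univ.filter p).card * Fintype.card F
      = ((Finset.univ.filter p) ×ˢ (Finset.univ : Finset F)).card := by
        rw [Finset.card_product, Finset.card_univ]
    _ ≤ ((Finset.univ : Finset (ι → F)).sigma fun u =>
          Finset.univ.filter fun t : F => p (Function.update u i t)).card := by
        refine Finset.card_le_card_of_injOn (fun a => ⟨Function.update a.1 i a.2, a.1 i⟩) ?_ ?_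
        · rintro ⟨u, x⟩ hu
          simp at hu ⊢
          exact hu
        · rintro ⟨u, x⟩ hu ⟨u', x'⟩ hu' he
          simp only [Sigma.mk.injEq, heq_eq_eq] at he
          obtain ⟨h1, h2⟩ := he
          have hx : x = x' := by simpa using congrFun h1 i
          have : u = u' := by
            funext j
            by_cases hj : j = i
            · rw [hj]; exact h2
            · simpa [hj] using congrFun h1 j
          rw [hx, this]
    _ = ∑ u : ι → F, (Finset.univ.filter fun t : F => p (Function.update u i t)).card := Finset.card_sigma _ _
    _ ≤ ∑ _u : ι → F, D := Finset.sum_le_sum fun u _ => h u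
    _ = _ := by simp [mul_comm]

lemma bad_count {F : Type*} [Field F] [Fintype F] [DecidableEq F] (h2 : (2 : F) ≠ 0) {n d : ℕ}
    (f : MvPolynomial (Fin (n + 1)) F) (hs : f.IsSymmetric) (hd : f.totalDegree ≤ d)
    (hadm : Admissible f) [DecidablePred fun z : Fin n × Bool → F => ¬ NSq (∏ ε : Fin n → Bool,
        (finSuccEquiv F n f).map (MvPolynomial.eval fun i => z (i, ε i)))] :
    (Finset.univ.filter fun z : Fin n × Bool → F => ¬ NSq (∏ ε : Fin n → Bool,
        (finSuccEquiv F n f).map (MvPolynomial.eval fun i => z (i, ε i)))).card * Fintype.card F ≤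
      (d + d * d + 2 ^ n * d) * Fintype.card F ^ (2 * n) := by
  classical
  obtain ⟨Q, hQ0, hQd, hQ⟩ := few_bad h2 f hs hd hadm.1
  set L := AlgebraicClosure F
  set p : (Fin n → F) → Polynomial F := fun y => (finSuccEquiv F n f).map (MvPolynomial.eval y) with hp
  have hal : ∀ y, ∃ α : L, MvPolynomial.eval y Q ≠ 0 →
      Odd (((p y).map (algebraMap F L)).rootMultiplicity α) := by
    intro y
    by_contra hc
    push Not at hc
    have h0 : MvPolynomial.eval y Q ≠ 0 := (hc 0).1
    exact h0 (hQ y (even_mult_square _ fun a => by simpa using (hc a).2))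
  choose α hα using hal
  set S0 := Finset.univ.filter fun z : Fin n × Bool → F => MvPolynomial.eval (fun i => z (i, false)) Q = 0
  set S : (Fin n → Bool) → Finset (Fin n × Bool → F) := fun ε => Finset.univ.filter fun z =>
    ((p fun i => z (i, ε i)).map (algebraMap F L)).eval (α fun i => z (i, false)) = 0
  have hsub : (Finset.univ.filter fun z : Fin n × Bool → F => ¬ NSq (∏ ε : Fin n → Bool,
        (finSuccEquiv F n f).map (MvPolynomial.eval fun i => z (i, ε i)))) ⊆
      S0 ∪ (Finset.univ.erase (fun _ => false)).biUnion S := by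
    intro z hz
    simp only [Finset.mem_filter, Finset.mem_univ, true_and] at hz
    by_contra hc
    apply hz
    simp only [S0, S, Finset.mem_union, Finset.mem_filter, Finset.mem_univ, true_and, Finset.mem_biUnion,
      Finset.mem_erase, not_or, not_exists, not_and, and_true] at hc
    obtain ⟨hc1, hc2⟩ := hc
    have ho := hα _ hc1
    refine NSq_of_odd _ (α fun i => z (i, false)) ?_
    rw [Polynomial.map_prod, ← Finset.mul_prod_erase Finset.univ _ (Finset.mem_univ (fun _ => false))]
    have hn1 : (p fun i => z (i, false)).map (algebraMap F L) ≠ 0 := by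
      intro h0
      rw [h0] at ho
      simp at ho
    have hev : (∏ ε ∈ Finset.univ.erase (fun _ => false),
        (p fun i => z (i, ε i)).map (algebraMap F L)).eval (α fun i => z (i, false)) ≠ 0 := by
      rw [Polynomial.eval_prod]
      refine Finset.prod_ne_zero_iff.2 fun ε hε => hc2 ε ?_
      simpa using hε
    have hn2 : (∏ ε ∈ Finset.univ.erase (fun _ => false),
        (p fun i => z (i, ε i)).map (algebraMap F L)) ≠ 0 := by
      intro h0
      rw [h0] at hev
      simp at hev
    rw [Polynomial.rootMultiplicity_mul (mul_ne_zero hn1 hn2), Polynomial.rootMultiplicity_eq_zero (p := ∏ ε ∈ Finset.univ.erase (fun _ => false),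
        (p fun i => z (i, ε i)).map (algebraMap F L)) hev, add_zero]
    exact ho
  have hS0 : S0.card * Fintype.card F ≤ (d + d * d) * Fintype.card F ^ (2 * n) := by
    have h1 : S0.card ≤ (Finset.univ.filter fun y : Fin n → F => MvPolynomial.eval y Q = 0).card * Fintype.card F ^ n := by
      calc S0.card ≤ ((Finset.univ.filter fun y : Fin n → F => MvPolynomial.eval y Q = 0) ×ˢ
            (Finset.univ : Finset (Fin n → F))).card := by
            refine Finset.card_le_card_of_injOn (fun z => (fun i => z (i, false), fun i => z (i, true))) ?_ ?_
            · intro z hz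
              simpa [S0] using hz
            · intro z _ z' _ he
              simp only [Prod.mk.injEq] at he
              funext ⟨i, b⟩
              cases b
              · exact congrFun he.1 i
              · exact congrFun he.2 i
        _ = _ := by simp [Finset.card_product]
    have h3 := sz_count Q hQ0
    calc S0.card * Fintype.card F ≤ _ * Fintype.card F := Nat.mul_le_mul_right _ h1
      _ = ((Finset.univ.filter fun y : Fin n → F => MvPolynomial.eval y Q = 0).card * Fintype.card F) * Fintype.card F ^ n := by ring
      _ ≤ ((d + d * d) * Fintype.card F ^ n) * Fintype.card F ^ n :=
        Nat.mul_le_mul_right _ (h3.trans (Nat.mul_le_mul_right _ hQd))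
      _ = _ := by ring
  have hS : ∀ ε ∈ Finset.univ.erase (fun _ : Fin n => false), (S ε).card * Fintype.card F ≤ d * Fintype.card F ^ (2 * n) := by
    intro ε hε
    obtain ⟨i, hi⟩ : ∃ i, ε i = true := by
      by_contra hc
      push Not at hc
      apply (Finset.mem_erase.1 hε).1
      funext j
      simpa using hc j
    have := fiber_count (F := F) (i, true) (fun z => ((p fun i => z (i, ε i)).map (algebraMap F L)).eval (α fun i => z (i, false)) = 0) d ?_
    · rw [Fintype.card_prod, Fintype.card_fin, Fintype.card_bool, mul_comm n 2] at this
      exact this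
    intro u
    refine le_trans (Finset.card_le_card ?_) (line_roots f hs hd hadm
      (Fin.cons (α fun i => u (i, false)) (fun j => algebraMap F L (u (j, ε j)))) i.succ)
    intro t ht
    simp only [Finset.mem_filter, Finset.mem_univ, true_and] at ht ⊢
    have e1 : (fun j => Function.update u (i, true) t (j, false)) = fun j => u (j, false) := by
      funext j; simp
    rw [e1] at ht
    rw [← ht, hp]
    have e2 : (Function.update (Fin.cons (α fun i => u (i, false)) (fun j => algebraMap F L (u (j, ε j)))) i.succ (algebraMap F L t) : Fin (n+1) → L)
        = Fin.cons (α fun i => u (i, false)) (fun j => algebraMap F L (Function.update u (i, true) t (j, ε j))) := by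
      rw [← Fin.cons_update]
      congr 1
      funext j
      by_cases hj : j = i
      · subst hj; simp [hi]
      · simp [hj]
    rw [e2, MvPolynomial.eval_eq_eval_mv_eval', ← substX_eq]
    beta_reduce
    rw [← substX_eq, substX_map]
    rfl
  calc _ ≤ (S0 ∪ (Finset.univ.erase (fun _ => false)).biUnion S).card * Fintype.card F :=
        Nat.mul_le_mul_right _ (Finset.card_le_card hsub)
    _ ≤ (S0.card + ∑ ε ∈ Finset.univ.erase (fun _ : Fin n => false), (S ε).card) * Fintype.card F :=
        Nat.mul_le_mul_right _ ((Finset.card_union_le _ _).trans (Nat.add_le_add_left Finset.card_biUnion_le _))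
    _ = S0.card * Fintype.card F + ∑ ε ∈ Finset.univ.erase (fun _ : Fin n => false), (S ε).card * Fintype.card F := by
        rw [add_mul, Finset.sum_mul]
    _ ≤ (d + d * d) * Fintype.card F ^ (2 * n) + ∑ ε ∈ Finset.univ.erase (fun _ : Fin n => false), d * Fintype.card F ^ (2 * n) :=
        Nat.add_le_add hS0 (Finset.sum_le_sum hS)
    _ ≤ (d + d * d) * Fintype.card F ^ (2 * n) + ∑ ε : Fin n → Bool, d * Fintype.card F ^ (2 * n) :=
        Nat.add_le_add_left (Finset.sum_le_sum_of_subset (Finset.erase_subset _ _)) _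
    _ = _ := by simp; ring
lemma sum_split {F : Type*} [Fintype F] [DecidableEq F] {n : ℕ} (g : (Fin (n + 1) → F) → ℤ) :
    ∑ u : Fin (n + 1) × Bool → F, ∏ ε : Fin (n + 1) → Bool, g (fun i => u (i, ε i)) =
    ∑ z : Fin n × Bool → F, (∑ x : F, ∏ ε : Fin n → Bool, g (Fin.cons x fun j => z (j, ε j))) ^ 2 := by
  let e : ((Fin n × Bool → F) × (Bool → F)) ≃ (Fin (n + 1) × Bool → F) :=
    { toFun := fun a ib => (Fin.cons (a.2 ib.2) (fun j => a.1 (j, ib.2)) : Fin (n + 1) → F) ib.1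
      invFun := fun u => (fun jb => u (jb.1.succ, jb.2), fun b => u (0, b))
      left_inv := by
        rintro ⟨z, x⟩
        simp
      right_inv := by
        intro u
        funext ⟨i, b⟩
        refine Fin.cases ?_ (fun j => ?_) i <;> simp }
  rw [← Equiv.sum_comp e, Fintype.sum_prod_type]
  refine Finset.sum_congr rfl fun z _ => ?_
  have h1 : (∑ x : F, ∏ ε : Fin n → Bool, g (Fin.cons x fun j => z (j, ε j))) ^ 2 =
      ∏ _b : Bool, ∑ x : F, ∏ ε : Fin n → Bool, g (Fin.cons x fun j => z (j, ε j)) := by simp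
  rw [h1, Finset.prod_univ_sum, Fintype.piFinset_univ]
  refine Finset.sum_congr rfl fun x _ => ?_
  rw [← Equiv.prod_comp (Fin.consEquiv fun _ => Bool), Fintype.prod_prod_type]
  refine Finset.prod_congr rfl fun b _ => ?_
  refine Finset.prod_congr rfl fun ε _ => ?_
  congr 1
  funext i
  refine Fin.cases ?_ (fun j => ?_) i
  · simp [e]
  · simp [e]

lemma char_abs_le {F : Type*} [Field F] [Fintype F] [DecidableEq F] (a : F) : |quadraticChar F a| ≤ 1 := by
  by_cases h : a = 0
  · simp [h]
  · rcases quadraticChar_dichotomy h with h | h <;> simp [h]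

lemma char_sum (n d : ℕ) : ∃ K : ℕ, ∀ (F : Type) [Field F] [Fintype F] [DecidableEq F],
    Odd (Fintype.card F) → ∀ f : MvPolynomial (Fin (n + 1)) F, f.IsSymmetric → f.totalDegree ≤ d →
    Admissible f →
    0 ≤ (∑ u : Fin (n + 1) × Bool → F, ∏ ε : Fin (n + 1) → Bool,
      quadraticChar F (MvPolynomial.eval (fun i => u (i, ε i)) f)) ∧
    (∑ u : Fin (n + 1) × Bool → F, ∏ ε : Fin (n + 1) → Bool,
      quadraticChar F (MvPolynomial.eval (fun i => u (i, ε i)) f)) * Fintype.card F ≤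
      K * (Fintype.card F : ℤ) ^ (2 * n + 2) := by
  classical
  obtain ⟨K, hK⟩ := weil (2 ^ n * d)
  refine ⟨K + (d + d * d + 2 ^ n * d), ?_⟩
  intro F _ _ _ hodd f hs hd hadm
  have h2 : (2 : F) ≠ 0 := by
    apply Ring.two_ne_zero
    intro h
    have := FiniteField.even_card_of_char_two h
    obtain ⟨t, ht⟩ := hodd
    omega
  have hsplit := sum_split (F := F) (n := n) (fun w => quadraticChar F (MvPolynomial.eval w f))
  rw [hsplit]
  refine ⟨Finset.sum_nonneg fun _ _ => sq_nonneg _, ?_⟩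
  set q := Fintype.card F with hq
  set G : (Fin n × Bool → F) → Polynomial F := fun z => ∏ ε : Fin n → Bool,
        (finSuccEquiv F n f).map (MvPolynomial.eval fun i => z (i, ε i)) with hG
  have hval : ∀ z, (∑ x : F, ∏ ε : Fin n → Bool, quadraticChar F (MvPolynomial.eval (Fin.cons x fun j => z (j, ε j)) f))
      = ∑ x : F, quadraticChar F ((G z).eval x) := by
    intro z
    refine Finset.sum_congr rfl fun x _ => ?_
    rw [hG, Polynomial.eval_prod, map_prod]
    refine Finset.prod_congr rfl fun ε _ => ?_
    rw [MvPolynomial.eval_eq_eval_mv_eval']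
  have hdeg : ∀ z, (G z).natDegree ≤ 2 ^ n * d := by
    intro z
    refine (Polynomial.natDegree_prod_le _ _).trans ?_
    calc _ ≤ ∑ _ε : Fin n → Bool, d := by
          refine Finset.sum_le_sum fun ε _ => ?_
          refine Polynomial.natDegree_map_le.trans ?_
          rw [MvPolynomial.natDegree_finSuccEquiv]
          exact (MvPolynomial.degreeOf_le_totalDegree f 0).trans hd
      _ = _ := by simp
  have hterm : ∀ z, (∑ x : F, quadraticChar F ((G z).eval x)) ^ 2 ≤ (K : ℤ) * q + (if ¬ NSq (G z) then (q : ℤ) ^ 2 else 0) := by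
    intro z
    by_cases h : NSq (G z)
    · simpa [h] using hK F hodd (G z) (hdeg z) h
    · rw [if_pos h]
      have h1 : |∑ x : F, quadraticChar F ((G z).eval x)| ≤ q := by
        refine (Finset.abs_sum_le_sum_abs _ _).trans ?_
        refine (Finset.sum_le_sum fun x _ => char_abs_le _).trans ?_
        simp [hq]
      have h3 : (∑ x : F, quadraticChar F ((G z).eval x)) ^ 2 ≤ (q : ℤ) ^ 2 := by
        rw [← sq_abs]
        exact pow_le_pow_left₀ (abs_nonneg _) h1 2
      have : (0 : ℤ) ≤ (K : ℤ) * q := by positivity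
      linarith
  have hbad := bad_count h2 f hs hd hadm
  rw [← hq] at hbad
  have hbad' : ((Finset.univ.filter fun z => ¬ NSq (G z)).card : ℤ) * q ≤ (d + d * d + 2 ^ n * d) * (q : ℤ) ^ (2 * n) := by
    exact_mod_cast hbad
  calc (∑ z : Fin n × Bool → F, (∑ x : F, ∏ ε : Fin n → Bool, quadraticChar F (MvPolynomial.eval (Fin.cons x fun j => z (j, ε j)) f)) ^ 2) * (q : ℤ)
      ≤ (∑ z : Fin n × Bool → F, ((K : ℤ) * q + (if ¬ NSq (G z) then (q : ℤ) ^ 2 else 0))) * q := by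
        refine mul_le_mul_of_nonneg_right (Finset.sum_le_sum fun z _ => ?_) (by positivity)
        rw [hval]
        exact hterm z
    _ = (K : ℤ) * q ^ (2 * n + 2) + (((Finset.univ.filter fun z => ¬ NSq (G z)).card : ℤ) * q) * q ^ 2 := by
        rw [Finset.sum_add_distrib, ← Finset.sum_filter, Finset.sum_const, Finset.sum_const, Finset.card_univ]
        rw [Fintype.card_fun, Fintype.card_prod, Fintype.card_fin, Fintype.card_bool, ← hq]
        simp only [nsmul_eq_mul]
        push_cast
        ring
    _ ≤ (K : ℤ) * q ^ (2 * n + 2) + ((d + d * d + 2 ^ n * d) * (q : ℤ) ^ (2 * n)) * q ^ 2 := by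
        gcongr
    _ = _ := by push_cast; ring

lemma except_count {F : Type*} [Field F] [Fintype F] [DecidableEq F] {n d : ℕ}
    (f : MvPolynomial (Fin (n + 1)) F) (hs : f.IsSymmetric) (hd : f.totalDegree ≤ d)
    (hadm : Admissible f) [DecidablePred fun u : Fin (n + 1) × Bool → F =>
      ¬ (Function.Injective u ∧ ∀ ε : Fin (n + 1) → Bool, MvPolynomial.eval (fun i => u (i, ε i)) f ≠ 0)] :
    (Finset.univ.filter fun u : Fin (n + 1) × Bool → F =>
      ¬ (Function.Injective u ∧ ∀ ε : Fin (n + 1) → Bool, MvPolynomial.eval (fun i => u (i, ε i)) f ≠ 0)).card * Fintype.card F ≤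
      ((2 * n + 2) ^ 2 + 2 ^ (n + 1) * d) * Fintype.card F ^ (2 * n + 2) := by
  classical
  set q := Fintype.card F with hq
  have hci : Fintype.card (Fin (n + 1) × Bool) = 2 * n + 2 := by simp; ring
  set A : (Fin (n + 1) × Bool) × (Fin (n + 1) × Bool) → Finset (Fin (n + 1) × Bool → F) := fun ab =>
    Finset.univ.filter fun u => ab.1 ≠ ab.2 ∧ u ab.1 = u ab.2
  set Z : (Fin (n + 1) → Bool) → Finset (Fin (n + 1) × Bool → F) := fun ε =>
    Finset.univ.filter fun u => MvPolynomial.eval (fun i => u (i, ε i)) f = 0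
  have hA : ∀ ab, (A ab).card * q ≤ 1 * q ^ (2 * n + 2) := by
    rintro ⟨a, b⟩
    rw [← hci]
    refine fiber_count a (fun u => a ≠ b ∧ u a = u b) 1 fun u => ?_
    by_cases hab : a = b
    · simp [hab]
    · have hba : b ≠ a := fun h => hab h.symm
      simp [hab, hba, Finset.filter_eq']
  have hZ : ∀ ε, (Z ε).card * q ≤ d * q ^ (2 * n + 2) := by
    intro ε
    rw [← hci]
    refine fiber_count (0, ε 0) (fun u => MvPolynomial.eval (fun i => u (i, ε i)) f = 0) d fun u => ?_
    refine le_trans (Finset.card_le_card ?_) (line_roots' f hs hd hadm (fun i => u (i, ε i)) 0)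
    intro t ht
    simp only [Finset.mem_filter, Finset.mem_univ, true_and] at ht ⊢
    rw [← ht]
    congr 2
    funext i
    by_cases hi : i = 0
    · subst hi; simp
    · simp [hi]
  calc _ ≤ (Finset.univ.biUnion A ∪ Finset.univ.biUnion Z).card * q := by
        refine Nat.mul_le_mul_right _ (Finset.card_le_card ?_)
        intro u hu
        simp only [Finset.mem_filter, Finset.mem_univ, true_and, not_and_or] at hu
        simp only [A, Z, Finset.mem_union, Finset.mem_biUnion, Finset.mem_filter, Finset.mem_univ, true_and]
        rcases hu with hu | hu
        · left
          simp only [Function.Injective] at hu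
          push Not at hu
          obtain ⟨a, b, h1, h3⟩ := hu
          exact ⟨(a, b), h3, h1⟩
        · right
          push Not at hu
          exact hu
    _ ≤ (∑ ab, (A ab).card + ∑ ε, (Z ε).card) * q :=
        Nat.mul_le_mul_right _ ((Finset.card_union_le _ _).trans (Nat.add_le_add Finset.card_biUnion_le Finset.card_biUnion_le))
    _ = ∑ ab, (A ab).card * q + ∑ ε, (Z ε).card * q := by rw [add_mul, Finset.sum_mul, Finset.sum_mul]
    _ ≤ ∑ _ab : (Fin (n + 1) × Bool) × (Fin (n + 1) × Bool), 1 * q ^ (2 * n + 2) + ∑ _ε : Fin (n + 1) → Bool, d * q ^ (2 * n + 2) :=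
        Nat.add_le_add (Finset.sum_le_sum fun ab _ => hA ab) (Finset.sum_le_sum fun ε _ => hZ ε)
    _ = _ := by
        rw [Finset.sum_const, Finset.sum_const, Finset.card_univ, Finset.card_univ, Fintype.card_prod, hci]
        simp
        ring

lemma NEPO_eq {F : Type*} [Field F] [Fintype F] [DecidableEq F] {k : ℕ} (f : MvPolynomial (Fin k) F)
    [DecidablePred fun u : Fin k × Bool → F => ¬ (Function.Injective u ∧ ∀ ε : Fin k → Bool, MvPolynomial.eval (fun i => u (i, ε i)) f ≠ 0)] :
    |2 * (NEPO f : ℤ) - (Fintype.card F : ℤ) ^ (2 * k) - ∑ u : Fin k × Bool → F, ∏ ε : Fin k → Bool,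
      quadraticChar F (MvPolynomial.eval (fun i => u (i, ε i)) f)| ≤
    2 * (Finset.univ.filter fun u : Fin k × Bool → F =>
      ¬ (Function.Injective u ∧ ∀ ε : Fin k → Bool, MvPolynomial.eval (fun i => u (i, ε i)) f ≠ 0)).card := by
  classical
  have h1 : (NEPO f : ℤ) = ∑ u : Fin k × Bool → F, if (Function.Injective u ∧
    Even (Finset.univ.filter fun ε : Fin k → Bool =>
      ¬ IsSquare (MvPolynomial.eval (fun i => u (i, ε i)) f)).card) then 1 else 0 := by
    rw [Finset.sum_boole]
    unfold NEPO
    rw [← Set.ncard_coe_finset]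
    congr 2
    ext u
    simp only [Set.mem_ofPred_eq, Finset.coe_filter, Finset.mem_univ, true_and]
    rw [← Set.ncard_coe_finset]
    simp
  have h3 : (Fintype.card F : ℤ) ^ (2 * k) = ∑ _u : Fin k × Bool → F, 1 := by
    simp [mul_comm]
  rw [h1, h3, Finset.mul_sum, ← Finset.sum_sub_distrib, ← Finset.sum_sub_distrib]
  refine (Finset.abs_sum_le_sum_abs _ _).trans ?_
  rw [← Finset.sum_boole, Finset.mul_sum]
  refine Finset.sum_le_sum fun u _ => ?_
  have hprod : |∏ ε : Fin k → Bool, quadraticChar F (MvPolynomial.eval (fun i => u (i, ε i)) f)| ≤ 1 := by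
    rw [Finset.abs_prod]
    exact Finset.prod_le_one (fun _ _ => abs_nonneg _) fun _ _ => char_abs_le _
  by_cases hg : Function.Injective u ∧ ∀ ε : Fin k → Bool, MvPolynomial.eval (fun i => u (i, ε i)) f ≠ 0
  · have hval : (∏ ε : Fin k → Bool, quadraticChar F (MvPolynomial.eval (fun i => u (i, ε i)) f)) =
        (-1) ^ (Finset.univ.filter fun ε : Fin k → Bool =>
          ¬ IsSquare (MvPolynomial.eval (fun i => u (i, ε i)) f)).card := by
      rw [← Finset.prod_const, Finset.prod_filter]
      refine Finset.prod_congr rfl fun ε _ => ?_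
      rw [quadraticChar_apply, quadraticCharFun, if_neg (hg.2 ε)]
      split_ifs <;> rfl
    rw [if_neg (not_not.2 hg), hval]
    by_cases he : Even (Finset.univ.filter fun ε : Fin k → Bool =>
          ¬ IsSquare (MvPolynomial.eval (fun i => u (i, ε i)) f)).card
    · rw [if_pos ⟨hg.1, he⟩, he.neg_one_pow]; norm_num
    · rw [if_neg (fun h => he h.2), (Nat.not_even_iff_odd.1 he).neg_one_pow]; norm_num
  · rw [if_pos hg]
    rw [abs_le] at hprod ⊢
    split_ifs <;> constructor <;> linarith [hprod.1, hprod.2]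

end Assembly

theorem stmt_0 (k d : ℕ) (hk : 2 ≤ k) (hd : 1 ≤ d) :
    ∃ C : ℝ, 0 < C ∧
      ∀ (q : ℕ) (F : Type) [Field F] [Fintype F],
        Fintype.card F = q → Odd q →
        ∀ f : MvPolynomial (Fin k) F, f.IsSymmetric → f.totalDegree = d → Admissible f →
          |(NEPO f : ℝ) - (q : ℝ) ^ (2 * k) / 2| ≤ C * (q : ℝ) ^ (2 * k - 1) := by
  classical
  obtain ⟨n, rfl⟩ : ∃ n, k = n + 1 := ⟨k - 1, by omega⟩
  obtain ⟨K, hK⟩ := char_sum n d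
  refine ⟨K + 2 * ((2 * n + 2) ^ 2 + 2 ^ (n + 1) * d) + 1, by positivity, ?_⟩
  intro q F _ _ hq hodd f hs hdeg hadm
  subst hq
  obtain ⟨hT0, hT⟩ := hK F hodd f hs hdeg.le hadm
  have hE := except_count f hs hdeg.le hadm
  have hN := NEPO_eq f
  set T := ∑ u : Fin (n + 1) × Bool → F, ∏ ε : Fin (n + 1) → Bool,
      quadraticChar F (MvPolynomial.eval (fun i => u (i, ε i)) f)
  set E := (Finset.univ.filter fun u : Fin (n + 1) × Bool → F =>
      ¬ (Function.Injective u ∧ ∀ ε : Fin (n + 1) → Bool, MvPolynomial.eval (fun i => u (i, ε i)) f ≠ 0)).card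
  set q := Fintype.card F
  have hq0 : (0 : ℝ) < q := by exact_mod_cast Fintype.card_pos
  have hT0' : (0 : ℝ) ≤ T := by exact_mod_cast hT0
  have hT' : (T : ℝ) * q ≤ K * (q : ℝ) ^ (2 * n + 2) := by exact_mod_cast hT
  have hE' : (E : ℝ) * q ≤ ((2 * n + 2) ^ 2 + 2 ^ (n + 1) * d) * (q : ℝ) ^ (2 * n + 2) := by exact_mod_cast hE
  have hN' : |2 * (NEPO f : ℝ) - (q : ℝ) ^ (2 * (n + 1)) - T| ≤ 2 * E := by exact_mod_cast hN
  have e1 : 2 * (n + 1) - 1 = 2 * n + 1 := by omega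
  rw [e1]
  have hTT : (T : ℝ) ≤ K * (q : ℝ) ^ (2 * n + 1) := by
    refine le_of_mul_le_mul_right ?_ hq0
    rw [mul_assoc, ← pow_succ]; exact hT'
  have hEE : (E : ℝ) ≤ ((2 * n + 2) ^ 2 + 2 ^ (n + 1) * d) * (q : ℝ) ^ (2 * n + 1) := by
    refine le_of_mul_le_mul_right ?_ hq0
    rw [mul_assoc, ← pow_succ]; exact hE'
  have hp : (0 : ℝ) < (q : ℝ) ^ (2 * n + 1) := pow_pos hq0 _
  have hE0 : (0 : ℝ) ≤ E := Nat.cast_nonneg _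
  rw [abs_le] at hN' ⊢
  constructor <;> nlinarith [hN'.1, hN'.2]
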